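/- For every positive integer n, every (9.8·10⁻⁵)-dense partial latin square of order n has a completion to a latin square of order n. -/

import Mathlib

/-- A partial latin square of order `n`: each symbol occurs at most once in
each row and at most once in each column. -/
def IsPartialLatinSquare {n : ℕ} (P : Fin n → Fin n → Option (Fin n)) : Prop :=
  (∀ i j j' s, P i j = some s → P i j' = some s → j = j') ∧
  (∀ i i' j s, P i j = some s → P i' j = some s → i = i')

/-- `P` is `ε`-dense: every row, column, and symbol of `P` has at most `ε * n`
filled cells. -/
def IsEpsDense {n : ℕ} (ε : ℝ) (P : Fin n → Fin n → Option (Fin n)) : Prop :=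
  (∀ i, ((Finset.univ.filter fun j => (P i j).isSome).card : ℝ) ≤ ε * n) ∧
  (∀ j, ((Finset.univ.filter fun i => (P i j).isSome).card : ℝ) ≤ ε * n) ∧
  (∀ s, ((Finset.univ.filter fun p : Fin n × Fin n => P p.1 p.2 = some s).card : ℝ) ≤ ε * n)

/-- A latin square of order `n`: every row and every column contains each
symbol exactly once. -/
def IsLatinSquare {n : ℕ} (L : Fin n → Fin n → Fin n) : Prop :=
  (∀ i, Function.Bijective (L i)) ∧ (∀ j, Function.Bijective fun i => L i j)

/-- `L` completes `P`. -/
def Completes {n : ℕ} (L : Fin n → Fin n → Fin n)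
    (P : Fin n → Fin n → Option (Fin n)) : Prop :=
  ∀ i j s, P i j = some s → L i j = s

/-- The number of filled cells of a partial latin square. -/
def filledCells {n : ℕ} (P : Fin n → Fin n → Option (Fin n)) : ℕ :=
  (Finset.univ.filter fun p : Fin n × Fin n => P p.1 p.2 ≠ none).card

/-! ### Counting helpers -/

section Counting

open Classical in
/-- number of elements of `H` satisfying `q` -/
noncomputable def cnt {X : Type*} (H : Finset X) (q : X → Prop) : ℕ := (H.filter q).card

open Classical in
theorem exists_avoid {X : Type*} (H : Finset X) : ∀ (l : List ((X → Prop) × ℕ)),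
    (∀ q ∈ l, cnt H q.1 ≤ q.2) → (l.map Prod.snd).sum < H.card →
    ∃ e ∈ H, ∀ q ∈ l, ¬ q.1 e := by
  intro l
  induction l generalizing H with
  | nil =>
    intro _ h
    obtain ⟨e, he⟩ := Finset.card_pos.mp (by simpa using h)
    exact ⟨e, he, by simp⟩
  | cons q l ih =>
    intro h1 h2
    unfold cnt at h1 ih
    have hq := h1 q (by simp)
    have hs := Finset.card_filter_add_card_filter_not (s := H) q.1
    simp only [List.map_cons, List.sum_cons] at h2
    obtain ⟨e, he, he2⟩ := ih (H.filter fun x => ¬ q.1 x) (by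
      intro q' hq'
      refine le_trans (Finset.card_le_card ?_) (h1 q' (by simp [hq']))
      exact Finset.filter_subset_filter _ (Finset.filter_subset _ _)) (by omega)
    rw [Finset.mem_filter] at he
    refine ⟨e, he.1, ?_⟩
    intro q' hq'
    rcases List.mem_cons.mp hq' with rfl | h
    · exact he.2
    · exact he2 q' h

open Classical in
theorem card_filter_le_inj {X Y : Type*} (H : Finset X) (q : X → Prop) (S : Finset Y) (φ : X → Y)
    (h1 : ∀ e ∈ H, q e → φ e ∈ S)
    (h2 : ∀ e ∈ H, ∀ e' ∈ H, q e → q e' → φ e = φ e' → e = e') :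
    cnt H q ≤ S.card := by
  unfold cnt
  refine Finset.card_le_card_of_injOn φ ?_ ?_
  · intro e he
    simp only [Finset.coe_filter, Set.mem_ofPred_eq] at he
    exact h1 e he.1 he.2
  · intro e he e' he' h
    simp only [Finset.coe_filter, Set.mem_ofPred_eq] at he he'
    exact h2 e he.1 e' he'.1 he.2 he'.2 h

open Classical in
theorem card_filter_le_one {X : Type*} (H : Finset X) (q : X → Prop)
    (h2 : ∀ e ∈ H, ∀ e' ∈ H, q e → q e' → e = e') :
    cnt H q ≤ 1 := by
  unfold cnt
  rw [Finset.card_le_one]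
  intro a ha b hb
  rw [Finset.mem_filter] at ha hb
  exact h2 a ha.1 b hb.1 ha.2 hb.2

open Classical in
theorem card_filter_inj_le {X Y : Type*} (H : Finset X) (φ : X → Y) (S : Finset Y)
    (h : ∀ e ∈ H, ∀ e' ∈ H, φ e = φ e' → e = e') :
    cnt H (fun e => φ e ∈ S) ≤ S.card :=
  card_filter_le_inj H _ S φ (fun _ _ h => h) (fun e he e' he' _ _ hh => h e he e' he' hh)

open Classical in
theorem markov_aux {X : Type*} (H : Finset X) (g : X → ℕ) (c d : ℕ) (q : X → Prop)
    (hq : ∀ e, q e → c ≤ d * g e) : cnt H q * c ≤ d * ∑ e ∈ H, g e := by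
  unfold cnt
  calc (H.filter q).card * c
      = ∑ e ∈ H.filter q, c := by simp
    _ ≤ ∑ e ∈ H.filter q, d * g e := by
        apply Finset.sum_le_sum
        intro e he
        exact hq e (Finset.mem_filter.mp he).2
    _ ≤ ∑ e ∈ H, d * g e :=
        Finset.sum_le_sum_of_subset (Finset.filter_subset _ _)
    _ = d * ∑ e ∈ H, g e := by rw [Finset.mul_sum]

/-- Markov's inequality, in the form `card * c ≤ Σ d * g`. -/
theorem markov_count {X : Type*} (H : Finset X) (g : X → ℕ) (c d : ℕ) :
    cnt H (fun e => c < d * g e) * c ≤ d * ∑ e ∈ H, g e :=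
  markov_aux H g c d _ (fun _ h => le_of_lt h)

open Classical in
theorem sum_fiber_le {X Y Z : Type*} (H : Finset X) (U : Finset Y) (f : Y → Z) (φ : X → Z)
    (h : ∀ e ∈ H, ∀ e' ∈ H, φ e = φ e' → e = e') :
    ∑ e ∈ H, (U.filter fun t => f t = φ e).card ≤ U.card := by
  rw [← Finset.card_biUnion]
  · apply Finset.card_le_card
    intro t ht
    simp only [Finset.mem_biUnion, Finset.mem_filter] at ht
    obtain ⟨_, _, h, _⟩ := ht
    exact h
  · intro e he e' he' hne
    rw [Function.onFun, Finset.disjoint_left]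
    intro t ht ht'
    rw [Finset.mem_filter] at ht ht'
    exact hne (h e he e' he' (ht.2.symm.trans ht'.2))

end Counting

/-! ### The model -/

abbrev Trp (V : Type*) := V × V × V

def pRC {V : Type*} (t : Trp V) : V × V := (t.1, t.2.1)
def pRS {V : Type*} (t : Trp V) : V × V := (t.1, t.2.2)
def pCS {V : Type*} (t : Trp V) : V × V := (t.2.1, t.2.2)

structure QModel (V : Type*) [Fintype V] where
  good : Finset V
  M : V → V → V → Prop
  fS : V → V → V
  fC : V → V → V
  fR : V → V → V
  p : V → Bool
  hS : ∀ r c s, M r c s ↔ r ∈ good ∧ c ∈ good ∧ fS r c = s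
  hC : ∀ r c s, M r c s ↔ r ∈ good ∧ s ∈ good ∧ fC r s = c
  hR : ∀ r c s, M r c s ↔ c ∈ good ∧ s ∈ good ∧ fR c s = r
  par : ∀ r c s, M r c s → (p r ^^ p c ^^ p s) = false
  quad : ∀ a b c a' b' c', M a b c → M a' b c' → M a' b' c → p a ≠ p a' → M a b' c'
  bal : ∀ b, 2 * (good.filter fun g => p g = b).card = good.card

namespace QModel

variable {V : Type*} [Fintype V] (Mo : QModel V)

theorem gR {r c s} (h : Mo.M r c s) : r ∈ Mo.good := ((Mo.hS _ _ _).1 h).1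
theorem gC {r c s} (h : Mo.M r c s) : c ∈ Mo.good := ((Mo.hS _ _ _).1 h).2.1
theorem gS {r c s} (h : Mo.M r c s) : s ∈ Mo.good := ((Mo.hC _ _ _).1 h).2.1
theorem mS {r c} (hr : r ∈ Mo.good) (hc : c ∈ Mo.good) : Mo.M r c (Mo.fS r c) :=
  (Mo.hS _ _ _).2 ⟨hr, hc, rfl⟩
theorem mC {r s} (hr : r ∈ Mo.good) (hs : s ∈ Mo.good) : Mo.M r (Mo.fC r s) s :=
  (Mo.hC _ _ _).2 ⟨hr, hs, rfl⟩
theorem mR {c s} (hc : c ∈ Mo.good) (hs : s ∈ Mo.good) : Mo.M (Mo.fR c s) c s :=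
  (Mo.hR _ _ _).2 ⟨hc, hs, rfl⟩
theorem uS {r c s s'} (h : Mo.M r c s) (h' : Mo.M r c s') : s = s' :=
  ((Mo.hS _ _ _).1 h).2.2.symm.trans ((Mo.hS _ _ _).1 h').2.2
theorem uC {r c c' s} (h : Mo.M r c s) (h' : Mo.M r c' s) : c = c' :=
  ((Mo.hC _ _ _).1 h).2.2.symm.trans ((Mo.hC _ _ _).1 h').2.2
theorem uR {r r' c s} (h : Mo.M r c s) (h' : Mo.M r' c s) : r = r' :=
  ((Mo.hR _ _ _).1 h).2.2.symm.trans ((Mo.hR _ _ _).1 h').2.2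

def swapRS : QModel V where
  good := Mo.good
  M r c s := Mo.M s c r
  fS r c := Mo.fR c r
  fC r s := Mo.fC s r
  fR c s := Mo.fS s c
  p := Mo.p
  hS r c s := by rw [Mo.hR]; tauto
  hC r c s := by rw [Mo.hC]; tauto
  hR r c s := by rw [Mo.hS]; tauto
  par r c s h := by
    have := Mo.par _ _ _ h
    revert this
    cases Mo.p r <;> cases Mo.p c <;> cases Mo.p s <;> simp
  quad a b c a' b' c' h1 h2 h3 hp := by
    refine Mo.quad c' b a' c b' a h2 h1 h3 ?_
    have e1 := Mo.par _ _ _ h1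
    have e2 := Mo.par _ _ _ h2
    revert e1 e2 hp
    cases Mo.p a <;> cases Mo.p a' <;> cases Mo.p b <;> cases Mo.p c <;> cases Mo.p c' <;> simp
  bal := Mo.bal

def swapRC : QModel V where
  good := Mo.good
  M r c s := Mo.M c r s
  fS r c := Mo.fS c r
  fC r s := Mo.fR r s
  fR c s := Mo.fC c s
  p := Mo.p
  hS r c s := by rw [Mo.hS]; tauto
  hC r c s := by rw [Mo.hR]
  hR r c s := by rw [Mo.hC]
  par r c s h := by
    have := Mo.par _ _ _ h
    revert this
    cases Mo.p r <;> cases Mo.p c <;> cases Mo.p s <;> simp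
  quad a b c a' b' c' h1 h2 h3 hp := by
    refine Mo.quad b' a' c b a c' h3 h2 h1 ?_
    have e1 := Mo.par _ _ _ h1
    have e2 := Mo.par _ _ _ h3
    revert e1 e2 hp
    cases Mo.p a <;> cases Mo.p a' <;> cases Mo.p b <;> cases Mo.p c <;> cases Mo.p b' <;> simp
  bal := Mo.bal

def swapCS : QModel V where
  good := Mo.good
  M r c s := Mo.M r s c
  fS r c := Mo.fC r c
  fC r s := Mo.fS r s
  fR c s := Mo.fR s c
  p := Mo.p
  hS r c s := by rw [Mo.hC]
  hC r c s := by rw [Mo.hS]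
  hR r c s := by rw [Mo.hR]; tauto
  par r c s h := by
    have := Mo.par _ _ _ h
    revert this
    cases Mo.p r <;> cases Mo.p c <;> cases Mo.p s <;> simp
  quad a b c a' b' c' h1 h2 h3 hp := Mo.quad a c b a' c' b' h1 h3 h2 hp
  bal := Mo.bal

end QModel

section Loads

open Classical in
noncomputable def rowL {V : Type*} (U : Finset (Trp V)) (r : V) : ℕ := (U.filter fun t => t.1 = r).card
open Classical in
noncomputable def colL {V : Type*} (U : Finset (Trp V)) (r : V) : ℕ := (U.filter fun t => t.2.1 = r).card
open Classical in
noncomputable def symL {V : Type*} (U : Finset (Trp V)) (r : V) : ℕ := (U.filter fun t => t.2.2 = r).card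

variable {V : Type*}

open Classical in
theorem rowL_union (U W : Finset (Trp V)) (r : V) : rowL (U ∪ W) r ≤ rowL U r + W.card := by
  unfold rowL
  rw [Finset.filter_union]
  exact (Finset.card_union_le _ _).trans (Nat.add_le_add_left (Finset.card_filter_le _ _) _)
open Classical in
theorem colL_union (U W : Finset (Trp V)) (r : V) : colL (U ∪ W) r ≤ colL U r + W.card := by
  unfold colL
  rw [Finset.filter_union]
  exact (Finset.card_union_le _ _).trans (Nat.add_le_add_left (Finset.card_filter_le _ _) _)
open Classical in
theorem symL_union (U W : Finset (Trp V)) (r : V) : symL (U ∪ W) r ≤ symL U r + W.card := by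
  unfold symL
  rw [Finset.filter_union]
  exact (Finset.card_union_le _ _).trans (Nat.add_le_add_left (Finset.card_filter_le _ _) _)

theorem sum_rowL {X : Type*} (H : Finset X) (U : Finset (Trp V)) (φ : X → V)
    (h : ∀ e ∈ H, ∀ e' ∈ H, φ e = φ e' → e = e') : ∑ e ∈ H, rowL U (φ e) ≤ U.card :=
  sum_fiber_le H U _ φ h
theorem sum_colL {X : Type*} (H : Finset X) (U : Finset (Trp V)) (φ : X → V)
    (h : ∀ e ∈ H, ∀ e' ∈ H, φ e = φ e' → e = e') : ∑ e ∈ H, colL U (φ e) ≤ U.card :=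
  sum_fiber_le H U _ φ h
theorem sum_symL {X : Type*} (H : Finset X) (U : Finset (Trp V)) (φ : X → V)
    (h : ∀ e ∈ H, ∀ e' ∈ H, φ e = φ e' → e = e') : ∑ e ∈ H, symL U (φ e) ≤ U.card :=
  sum_fiber_le H U _ φ h

open Classical in
/-- number of parameters whose triple (in a fixed row) is in `U` -/
theorem cnt_row {X : Type*} (H : Finset X) (U : Finset (Trp V)) (r : V) (f g : X → V)
    (h : ∀ e ∈ H, ∀ e' ∈ H, f e = f e' → g e = g e' → e = e') :
    cnt H (fun e => (r, f e, g e) ∈ U) ≤ rowL U r := by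
  refine card_filter_le_inj H _ _ (fun e => (r, f e, g e)) ?_ ?_
  · intro e _ he
    exact Finset.mem_filter.mpr ⟨he, rfl⟩
  · intro e he e' he' _ _ hh
    simp only [Prod.mk.injEq] at hh
    exact h e he e' he' hh.2.1 hh.2.2
open Classical in
theorem cnt_col {X : Type*} (H : Finset X) (U : Finset (Trp V)) (r : V) (f g : X → V)
    (h : ∀ e ∈ H, ∀ e' ∈ H, f e = f e' → g e = g e' → e = e') :
    cnt H (fun e => (f e, r, g e) ∈ U) ≤ colL U r := by
  refine card_filter_le_inj H _ _ (fun e => (f e, r, g e)) ?_ ?_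
  · intro e _ he
    exact Finset.mem_filter.mpr ⟨he, rfl⟩
  · intro e he e' he' _ _ hh
    simp only [Prod.mk.injEq] at hh
    exact h e he e' he' hh.1 hh.2.2
open Classical in
theorem cnt_sym {X : Type*} (H : Finset X) (U : Finset (Trp V)) (r : V) (f g : X → V)
    (h : ∀ e ∈ H, ∀ e' ∈ H, f e = f e' → g e = g e' → e = e') :
    cnt H (fun e => (f e, g e, r) ∈ U) ≤ symL U r := by
  refine card_filter_le_inj H _ _ (fun e => (f e, g e, r)) ?_ ?_
  · intro e _ he
    exact Finset.mem_filter.mpr ⟨he, rfl⟩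
  · intro e he e' he' _ _ hh
    simp only [Prod.mk.injEq] at hh
    exact h e he e' he' hh.1 hh.2.1

end Loads

structure IsFill {V : Type*} [Fintype V] (Mo : QModel V) (U : Finset (Trp V)) (B : ℕ) (x a u v : V)
    (P Ng : Multiset (Trp V)) : Prop where
  rc : P.map pRC = Ng.map pRC
  cs : P.map pCS = Ng.map pCS
  rs : P.map pRS + {(x, v)} + {(a, u)} = Ng.map pRS + {(x, u)} + {(a, v)}
  nodup : Ng.Nodup
  nat : ∀ t ∈ Ng, Mo.M t.1 t.2.1 t.2.2
  av : ∀ t ∈ Ng, t ∉ U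
  card : Multiset.card Ng ≤ B

section Fillers

variable {V : Type*} [Fintype V]

theorem good_half (Mo : QModel V) (b : Bool) :
    2 * (Mo.good.filter fun g => Mo.p g ≠ b).card = Mo.good.card := by
  rw [← Mo.bal (!b)]
  congr 3
  ext g
  cases Mo.p g <;> cases b <;> simp

theorem matched_filler (Mo : QModel V) (U : Finset (Trp V)) (x a u v e1 e2 : V)
    (hxa : x ≠ a) (huv : u ≠ v) (hu : u ∈ Mo.good) (hv : v ∈ Mo.good)
    (h1 : Mo.M x e1 v) (h2 : Mo.M a e2 u)
    (n1 : (x, e1, v) ∉ U) (n2 : (a, e2, u) ∉ U) (hp : Mo.p e1 = Mo.p e2)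
    (hL : 2 * (rowL U x + colL U e1 + symL U v + rowL U a + colL U e2 + symL U u + 2) < Mo.good.card) :
    ∃ P Ng, IsFill Mo U 8 x a u v P Ng := by
  have hx := Mo.gR h1
  have ha := Mo.gR h2
  have he1 := Mo.gC h1
  have he2 := Mo.gC h2
  by_cases he : e1 = e2
  · subst he
    refine ⟨{(x, e1, u)} + {(a, e1, v)}, {(x, e1, v)} + {(a, e1, u)}, ?_, ?_, ?_, ?_, ?_, ?_, ?_⟩
    · simp [pRC]
    · simp only [pCS, Multiset.map_add, Multiset.map_singleton]; abel
    · simp only [pRS, Multiset.map_add, Multiset.map_singleton]; abel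
    · simp [hxa]
    · intro t ht
      simp only [Multiset.mem_add, Multiset.mem_singleton] at ht
      rcases ht with rfl | rfl
      · exact h1
      · exact h2
    · intro t ht
      simp only [Multiset.mem_add, Multiset.mem_singleton] at ht
      rcases ht with rfl | rfl
      · exact n1
      · exact n2
    · simp
  · have hcard := good_half Mo (Mo.p e1)
    set H := Mo.good.filter fun g => Mo.p g ≠ Mo.p e1 with hH
    have memH : ∀ e ∈ H, e ∈ Mo.good ∧ Mo.p e ≠ Mo.p e1 := fun e h => Finset.mem_filter.mp h
    obtain ⟨e, heH, hav⟩ := exists_avoid H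
      [ (fun e => Mo.M x e u, 1), (fun e => Mo.M a e v, 1),
        (fun e => (x, e, Mo.fS x e) ∈ U, rowL U x),
        (fun e => (Mo.fR e v, e1, Mo.fS x e) ∈ U, colL U e1),
        (fun e => (Mo.fR e v, e, v) ∈ U, symL U v),
        (fun e => (a, e, Mo.fS a e) ∈ U, rowL U a),
        (fun e => (Mo.fR e u, e2, Mo.fS a e) ∈ U, colL U e2),
        (fun e => (Mo.fR e u, e, u) ∈ U, symL U u) ] (by
        simp only [List.forall_mem_cons]
        refine ⟨?_, ?_, ?_, ?_, ?_, ?_, ?_, ?_, by simp⟩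
        · exact card_filter_le_one _ _ (fun e _ e' _ h h' => Mo.uC h h')
        · exact card_filter_le_one _ _ (fun e _ e' _ h h' => Mo.uC h h')
        · exact cnt_row _ _ _ _ _ (fun e _ e' _ h _ => h)
        · refine cnt_col _ _ _ _ _ (fun e h e' h' _ hh => ?_)
          have q1 := Mo.mS hx (memH e h).1
          have q2 := Mo.mS hx (memH e' h').1
          rw [hh] at q1
          exact Mo.uC q1 q2
        · exact cnt_sym _ _ _ _ _ (fun e _ e' _ _ h => h)
        · exact cnt_row _ _ _ _ _ (fun e _ e' _ h _ => h)
        · refine cnt_col _ _ _ _ _ (fun e h e' h' _ hh => ?_)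
          have q1 := Mo.mS ha (memH e h).1
          have q2 := Mo.mS ha (memH e' h').1
          rw [hh] at q1
          exact Mo.uC q1 q2
        · exact cnt_sym _ _ _ _ _ (fun e _ e' _ _ h => h)) (by
        simp only [List.map_cons, List.map_nil, List.sum_cons, List.sum_nil]
        omega)
    simp only [List.forall_mem_cons] at hav
    obtain ⟨b1, b2, b3, b4, b5, b6, b7, b8, -⟩ := hav
    obtain ⟨heg, hep⟩ := memH e heH
    have m1 := Mo.mS hx heg
    have m2 := Mo.mR heg hv
    have m3 := Mo.mS ha heg
    have m4 := Mo.mR heg hu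
    set v' := Mo.fS x e
    set x' := Mo.fR e v
    set u' := Mo.fS a e
    set a' := Mo.fR e u
    have px : Mo.p x' ≠ Mo.p x := by
      have q1 := Mo.par _ _ _ h1
      have q2 := Mo.par _ _ _ m2
      revert q1 q2 hep
      cases Mo.p x <;> cases Mo.p x' <;> cases Mo.p e1 <;> cases Mo.p e <;> cases Mo.p v <;> simp
    have pa : Mo.p a' ≠ Mo.p a := by
      have q1 := Mo.par _ _ _ h2
      have q2 := Mo.par _ _ _ m4
      rw [hp] at hep
      revert q1 q2 hep
      cases Mo.p a <;> cases Mo.p a' <;> cases Mo.p e2 <;> cases Mo.p e <;> cases Mo.p u <;> simp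
    have m5 : Mo.M x' e1 v' := Mo.quad x' e v x e1 v' m2 m1 h1 px
    have m6 : Mo.M a' e2 u' := Mo.quad a' e u a e2 u' m4 m3 h2 pa
    have d1 : x ≠ x' := fun h => px (by rw [← h])
    have d2 : a ≠ a' := fun h => pa (by rw [← h])
    have d3 : e ≠ e1 := fun h => hep (by rw [← h])
    have d4 : e ≠ e2 := fun h => hep (by rw [hp, ← h])
    have d5 : x ≠ a' := fun h => b1 (by rw [h]; exact m4)
    have d6 : x' ≠ a := fun h => b2 (by rw [← h]; exact m2)
    have d7 : x' ≠ a' := fun h => huv (Mo.uS (by rw [h]; exact m4) m2)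
    refine ⟨{(x, e, u)} + {(a, e, v)} + {(x, e1, v')} + {(x', e1, v)} + {(x', e, v')} + {(a, e2, u')}
        + {(a', e2, u)} + {(a', e, u')},
      {(x, e1, v)} + {(x, e, v')} + {(x', e1, v')} + {(x', e, v)} + {(a, e2, u)} + {(a, e, u')}
        + {(a', e2, u')} + {(a', e, u)}, ?_, ?_, ?_, ?_, ?_, ?_, ?_⟩
    · simp only [pRC, Multiset.map_add, Multiset.map_singleton]; abel
    · simp only [pCS, Multiset.map_add, Multiset.map_singleton]; abel
    · simp only [pRS, Multiset.map_add, Multiset.map_singleton]; abel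
    · simp only [Multiset.singleton_add, Multiset.cons_add, Multiset.nodup_cons, Multiset.mem_cons,
        Multiset.mem_singleton, Multiset.nodup_singleton, Prod.mk.injEq, not_or, and_true]
      refine ⟨⟨?_, ?_, ?_, ?_, ?_, ?_, ?_⟩, ⟨?_, ?_, ?_, ?_, ?_, ?_⟩, ⟨?_, ?_, ?_, ?_, ?_⟩,
        ⟨?_, ?_, ?_, ?_⟩, ⟨?_, ?_, ?_⟩, ⟨?_, ?_⟩, ?_⟩
      all_goals grind
    · intro t ht
      simp only [Multiset.mem_add, Multiset.mem_singleton] at ht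
      rcases ht with ((((((rfl | rfl) | rfl) | rfl) | rfl) | rfl) | rfl) | rfl
      all_goals assumption
    · intro t ht
      simp only [Multiset.mem_add, Multiset.mem_singleton] at ht
      rcases ht with ((((((rfl | rfl) | rfl) | rfl) | rfl) | rfl) | rfl) | rfl
      all_goals assumption
    · simp

theorem card_le_of_markov {N b c d S : ℕ} (hN : 0 < N) (h : b * (c * N) ≤ S) (hS : S ≤ d * N ^ 2) :
    b * c ≤ d * N := by
  have : b * c * N ≤ d * N * N := by nlinarith
  exact Nat.le_of_mul_le_mul_right this hN

open Classical in
theorem hop_filler (Mo : QModel V) (U : Finset (Trp V)) (x a u v e1 e2 : V)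
    (hxa : x ≠ a) (huv : u ≠ v) (hu : u ∈ Mo.good) (hv : v ∈ Mo.good)
    (h1 : Mo.M x e1 v) (h2 : Mo.M a e2 u)
    (n1 : (x, e1, v) ∉ U) (n2 : (a, e2, u) ∉ U) (hp : Mo.p e1 ≠ Mo.p e2)
    (hpuv : Mo.p u ≠ Mo.p v) (hN : 10000 ≤ Mo.good.card)
    (hL : 3 * (rowL U x + colL U e1 + symL U v + rowL U a + colL U e2 + symL U u) ≤ Mo.good.card)
    (hU : 150 * U.card ≤ Mo.good.card ^ 2) :
    ∃ P Ng, IsFill Mo U 16 x a u v P Ng := by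
  have hx := Mo.gR h1
  have ha := Mo.gR h2
  have pxa : Mo.p x = Mo.p a := by
    have q1 := Mo.par _ _ _ h1
    have q2 := Mo.par _ _ _ h2
    revert q1 q2 hp hpuv
    cases Mo.p x <;> cases Mo.p a <;> cases Mo.p e1 <;> cases Mo.p e2 <;> cases Mo.p u <;>
      cases Mo.p v <;> simp
  set N := Mo.good.card with hNdef
  have hcard := good_half Mo (Mo.p x)
  set H := Mo.good.filter fun g => Mo.p g ≠ Mo.p x with hH
  have memH : ∀ e ∈ H, e ∈ Mo.good ∧ Mo.p e ≠ Mo.p x := fun e h => Finset.mem_filter.mp h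
  have injC : ∀ w ∈ Mo.good, ∀ k ∈ H, ∀ k' ∈ H, Mo.fC k w = Mo.fC k' w → k = k' := by
    intro w hw k hk k' hk' h
    have q1 := Mo.mC (memH k hk).1 hw
    have q2 := Mo.mC (memH k' hk').1 hw
    rw [h] at q1
    exact Mo.uR q1 q2
  have hmk := markov_count H (fun k => rowL U k + colL U (Mo.fC k u) + colL U (Mo.fC k v)) (3 * N) 20
  have hsum : ∑ k ∈ H, (rowL U k + colL U (Mo.fC k u) + colL U (Mo.fC k v)) ≤ 3 * U.card := by
    rw [Finset.sum_add_distrib, Finset.sum_add_distrib]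
    have q1 := sum_rowL H U (fun k => k) (fun e _ e' _ h => h)
    have q2 := sum_colL H U (fun k => Mo.fC k u) (injC u hu)
    have q3 := sum_colL H U (fun k => Mo.fC k v) (injC v hv)
    omega
  set bd := cnt H (fun k => 3 * N < 20 * (rowL U k + colL U (Mo.fC k u) + colL U (Mo.fC k v))) with hbd
  have hb : bd * 15 ≤ 2 * N := by
    have e1 : (5 * bd) * (3 * N) ≤ 300 * U.card := by nlinarith
    have := card_le_of_markov (N := N) (b := 5 * bd) (c := 3) (d := 2) (by omega) e1 (by omega)
    omega
  obtain ⟨k, hkH, hav⟩ := exists_avoid H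
      [ (fun k => (k, Mo.fC k u, u) ∈ U, symL U u),
        (fun k => (k, Mo.fC k v, v) ∈ U, symL U v),
        (fun k => 3 * N < 20 * (rowL U k + colL U (Mo.fC k u) + colL U (Mo.fC k v)), bd) ] (by
        simp only [List.forall_mem_cons]
        refine ⟨?_, ?_, ?_, by simp⟩
        · exact cnt_sym _ _ _ _ _ (fun e _ e' _ h _ => h)
        · exact cnt_sym _ _ _ _ _ (fun e _ e' _ h _ => h)
        · exact le_rfl) (by
        simp only [List.map_cons, List.map_nil, List.sum_cons, List.sum_nil]
        omega)
  simp only [List.forall_mem_cons] at hav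
  obtain ⟨b1, b2, b3, -⟩ := hav
  obtain ⟨hkg, hkp⟩ := memH k hkH
  have mu := Mo.mC hkg hu
  have mv := Mo.mC hkg hv
  set cu := Mo.fC k u
  set cv := Mo.fC k v
  have hkx : x ≠ k := fun h => hkp (by rw [h])
  have hka : k ≠ a := fun h => hkp (by rw [pxa, h])
  have pp : Mo.p e1 = Mo.p cu ∧ Mo.p cv = Mo.p e2 := by
    have q1 := Mo.par _ _ _ h1
    have q2 := Mo.par _ _ _ h2
    have q3 := Mo.par _ _ _ mu
    have q4 := Mo.par _ _ _ mv
    rw [pxa] at *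
    revert q1 q2 q3 q4 hpuv hkp
    cases Mo.p k <;> cases Mo.p a <;> cases Mo.p e1 <;> cases Mo.p e2 <;> cases Mo.p u <;>
      cases Mo.p v <;> simp +contextual
  set W : Finset (Trp V) := {(k, cv, v), (a, e2, u)} with hW
  have cW : W.card ≤ 2 := Finset.card_le_two
  obtain ⟨P1, N1, F1⟩ := matched_filler Mo (U ∪ W) x k u v e1 cu hkx huv hu hv h1 mu
    (by simp [hW, n1, hkx, hxa]) (by simp [hW, b1, hka, huv]) pp.1 (by
      have := rowL_union U W x
      have := colL_union U W e1
      have := symL_union U W v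
      have := rowL_union U W k
      have := colL_union U W cu
      have := symL_union U W u
      omega)
  have cN : N1.toFinset.card ≤ 8 := (Multiset.toFinset_card_le _).trans F1.card
  have avW : ∀ t ∈ W, t ∉ N1 := fun t ht h => F1.av t h (Finset.mem_union_right _ ht)
  obtain ⟨P2, N2, F2⟩ := matched_filler Mo (U ∪ N1.toFinset) k a u v cv e2 hka huv hu hv mv h2
    (by
      have := avW (k, cv, v) (by simp [hW])
      simp [b2, this]) (by
      have := avW (a, e2, u) (by simp [hW])
      simp [n2, this]) pp.2 (by
      have := rowL_union U N1.toFinset a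
      have := colL_union U N1.toFinset e2
      have := symL_union U N1.toFinset v
      have := rowL_union U N1.toFinset k
      have := colL_union U N1.toFinset cv
      have := symL_union U N1.toFinset u
      omega)
  refine ⟨P1 + P2, N1 + N2, ?_, ?_, ?_, ?_, ?_, ?_, ?_⟩
  · simp [F1.rc, F2.rc]
  · simp [F1.cs, F2.cs]
  · have g1 := F1.rs
    have g2 := F2.rs
    have g3 := congrArg₂ (· + ·) g1 g2
    rw [Multiset.map_add, Multiset.map_add]
    apply add_right_cancel (b := ({(k, u)} + {(k, v)} : Multiset (V × V)))
    refine Eq.trans ?_ (g3.trans ?_) <;> abel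
  · rw [Multiset.nodup_add]
    refine ⟨F1.nodup, F2.nodup, ?_⟩
    rw [Multiset.disjoint_left]
    intro t h1 h2
    exact F2.av t h2 (Finset.mem_union_right _ (Multiset.mem_toFinset.2 h1))
  · intro t ht
    rcases Multiset.mem_add.1 ht with h | h
    · exact F1.nat t h
    · exact F2.nat t h
  · intro t ht hU
    rcases Multiset.mem_add.1 ht with h | h
    · exact F1.av t h (Finset.mem_union_left _ hU)
    · exact F2.av t h (Finset.mem_union_left _ hU)
  · rw [Multiset.card_add]
    have := F1.card
    have := F2.card
    omega

end Fillers

def swpRS {V : Type*} (t : Trp V) : Trp V := (t.2.2, t.2.1, t.1)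
def swpRC {V : Type*} (t : Trp V) : Trp V := (t.2.1, t.1, t.2.2)
def swpCS {V : Type*} (t : Trp V) : Trp V := (t.1, t.2.2, t.2.1)

section Swaps

variable {V : Type*}

theorem swpRS_inj : Function.Injective (swpRS (V := V)) := by
  rintro ⟨a, b, c⟩ ⟨a', b', c'⟩ h
  simp only [swpRS, Prod.mk.injEq] at h ⊢
  tauto
theorem swpRC_inj : Function.Injective (swpRC (V := V)) := by
  rintro ⟨a, b, c⟩ ⟨a', b', c'⟩ h
  simp only [swpRC, Prod.mk.injEq] at h ⊢
  tauto
theorem swpCS_inj : Function.Injective (swpCS (V := V)) := by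
  rintro ⟨a, b, c⟩ ⟨a', b', c'⟩ h
  simp only [swpCS, Prod.mk.injEq] at h ⊢
  tauto

open Classical in
theorem card_filter_map {X Y : Type*} (U : Finset X) (f : X ↪ Y) (p : Y → Prop) (q : X → Prop)
    (h : ∀ x, p (f x) ↔ q x) : ((U.map f).filter p).card = (U.filter q).card := by
  rw [Finset.filter_map, Finset.card_map]
  congr 1
  ext x
  simp [h]

theorem rowL_RS (U : Finset (Trp V)) (r : V) : rowL (U.map ⟨swpRS, swpRS_inj⟩) r = symL U r :=
  card_filter_map _ _ _ _ (fun _ => Iff.rfl)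
theorem colL_RS (U : Finset (Trp V)) (r : V) : colL (U.map ⟨swpRS, swpRS_inj⟩) r = colL U r :=
  card_filter_map _ _ _ _ (fun _ => Iff.rfl)
theorem symL_RS (U : Finset (Trp V)) (r : V) : symL (U.map ⟨swpRS, swpRS_inj⟩) r = rowL U r :=
  card_filter_map _ _ _ _ (fun _ => Iff.rfl)
theorem rowL_RC (U : Finset (Trp V)) (r : V) : rowL (U.map ⟨swpRC, swpRC_inj⟩) r = colL U r :=
  card_filter_map _ _ _ _ (fun _ => Iff.rfl)
theorem colL_RC (U : Finset (Trp V)) (r : V) : colL (U.map ⟨swpRC, swpRC_inj⟩) r = rowL U r :=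
  card_filter_map _ _ _ _ (fun _ => Iff.rfl)
theorem symL_RC (U : Finset (Trp V)) (r : V) : symL (U.map ⟨swpRC, swpRC_inj⟩) r = symL U r :=
  card_filter_map _ _ _ _ (fun _ => Iff.rfl)
theorem rowL_CS (U : Finset (Trp V)) (r : V) : rowL (U.map ⟨swpCS, swpCS_inj⟩) r = rowL U r :=
  card_filter_map _ _ _ _ (fun _ => Iff.rfl)
theorem colL_CS (U : Finset (Trp V)) (r : V) : colL (U.map ⟨swpCS, swpCS_inj⟩) r = symL U r :=
  card_filter_map _ _ _ _ (fun _ => Iff.rfl)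
theorem symL_CS (U : Finset (Trp V)) (r : V) : symL (U.map ⟨swpCS, swpCS_inj⟩) r = colL U r :=
  card_filter_map _ _ _ _ (fun _ => Iff.rfl)

theorem mem_RS (U : Finset (Trp V)) (t : Trp V) :
    t ∈ U.map ⟨swpRS, swpRS_inj⟩ ↔ swpRS t ∈ U := by
  obtain ⟨a, b, c⟩ := t
  simp only [Finset.mem_map, Function.Embedding.coeFn_mk]
  constructor
  · rintro ⟨s, hs, h⟩
    rw [← h]; exact hs
  · intro h
    exact ⟨_, h, rfl⟩
theorem mem_RC (U : Finset (Trp V)) (t : Trp V) :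
    t ∈ U.map ⟨swpRC, swpRC_inj⟩ ↔ swpRC t ∈ U := by
  obtain ⟨a, b, c⟩ := t
  simp only [Finset.mem_map, Function.Embedding.coeFn_mk]
  constructor
  · rintro ⟨s, hs, h⟩
    rw [← h]; exact hs
  · intro h
    exact ⟨_, h, rfl⟩
theorem mem_CS (U : Finset (Trp V)) (t : Trp V) :
    t ∈ U.map ⟨swpCS, swpCS_inj⟩ ↔ swpCS t ∈ U := by
  obtain ⟨a, b, c⟩ := t
  simp only [Finset.mem_map, Function.Embedding.coeFn_mk]
  constructor
  · rintro ⟨s, hs, h⟩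
    rw [← h]; exact hs
  · intro h
    exact ⟨_, h, rfl⟩

theorem map_swap_pair {X : Type*} (S : Multiset X) (f g : X → V × V)
    (h : ∀ x, g x = Prod.swap (f x)) : S.map g = (S.map f).map Prod.swap := by
  rw [Multiset.map_map]
  exact Multiset.map_congr rfl (fun x _ => h x)

variable [Fintype V]

theorem filler_RS (Mo : QModel V) (U : Finset (Trp V)) (x a u v e1 e2 : V)
    (hxa : x ≠ a) (huv : u ≠ v)
    (h1 : Mo.M x e1 v) (h2 : Mo.M a e2 u)
    (n1 : (x, e1, v) ∉ U) (n2 : (a, e2, u) ∉ U) (hN : 10000 ≤ Mo.good.card)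
    (hL : 3 * (rowL U x + colL U e1 + symL U v + rowL U a + colL U e2 + symL U u) ≤ Mo.good.card)
    (hU : 150 * U.card ≤ Mo.good.card ^ 2) :
    ∃ P Ng, IsFill Mo U 16 x a u v P Ng := by
  have hx := Mo.gR h1
  have ha := Mo.gR h2
  have hv := Mo.gS h1
  have hu := Mo.gS h2
  by_cases hp : Mo.p e1 = Mo.p e2
  · obtain ⟨P, Ng, F⟩ := matched_filler Mo U x a u v e1 e2 hxa huv hu hv h1 h2 n1 n2 hp (by omega)
    exact ⟨P, Ng, F.rc, F.cs, F.rs, F.nodup, F.nat, F.av, F.card.trans (by norm_num)⟩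
  by_cases hpuv : Mo.p u = Mo.p v
  · have pxa : Mo.p x ≠ Mo.p a := by
      have q1 := Mo.par _ _ _ h1
      have q2 := Mo.par _ _ _ h2
      revert q1 q2 hp hpuv
      cases Mo.p x <;> cases Mo.p a <;> cases Mo.p e1 <;> cases Mo.p e2 <;> cases Mo.p u <;>
        cases Mo.p v <;> simp
    obtain ⟨P, Ng, F⟩ := hop_filler Mo.swapRS (U.map ⟨swpRS, swpRS_inj⟩) u v x a e2 e1
      huv hxa hx ha h2 h1 (by rw [mem_RS]; exact n2) (by rw [mem_RS]; exact n1) (Ne.symm hp) pxa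
      hN (by
        simp only [rowL_RS, colL_RS, symL_RS]
        show _ ≤ Mo.good.card
        omega) (by rw [Finset.card_map]; exact hU)
    refine ⟨P.map swpRS, Ng.map swpRS, ?_, ?_, ?_, ?_, ?_, ?_, ?_⟩
    · rw [Multiset.map_map, Multiset.map_map]
      have := congrArg (Multiset.map Prod.swap) F.cs
      rw [← map_swap_pair P pCS (pRC ∘ swpRS) (fun _ => rfl),
        ← map_swap_pair Ng pCS (pRC ∘ swpRS) (fun _ => rfl)] at this
      exact this
    · rw [Multiset.map_map, Multiset.map_map]
      have := congrArg (Multiset.map Prod.swap) F.rc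
      rw [← map_swap_pair P pRC (pCS ∘ swpRS) (fun _ => rfl),
        ← map_swap_pair Ng pRC (pCS ∘ swpRS) (fun _ => rfl)] at this
      exact this
    · rw [Multiset.map_map, Multiset.map_map]
      have := congrArg (Multiset.map Prod.swap) F.rs
      simp only [Multiset.map_add, Multiset.map_singleton, Prod.swap_prod_mk] at this
      rw [← map_swap_pair P pRS (pRS ∘ swpRS) (fun _ => rfl),
        ← map_swap_pair Ng pRS (pRS ∘ swpRS) (fun _ => rfl)] at this
      refine Eq.trans ?_ (this.trans ?_) <;> abel
    · exact F.nodup.map swpRS_inj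
    · intro t ht
      obtain ⟨t', ht', rfl⟩ := Multiset.mem_map.1 ht
      exact F.nat t' ht'
    · intro t ht
      obtain ⟨t', ht', rfl⟩ := Multiset.mem_map.1 ht
      have := F.av t' ht'
      rw [mem_RS] at this
      exact this
    · rw [Multiset.card_map]; exact F.card
  · exact hop_filler Mo U x a u v e1 e2 hxa huv hu hv h1 h2 n1 n2 hp hpuv hN hL hU

/-- filler with boundary on column-symbol pairs -/
theorem filler_CS (Mo : QModel V) (U : Finset (Trp V)) (x a u v e1 e2 : V)
    (hxa : x ≠ a) (huv : u ≠ v)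
    (h1 : Mo.M e1 x v) (h2 : Mo.M e2 a u)
    (n1 : (e1, x, v) ∉ U) (n2 : (e2, a, u) ∉ U) (hN : 10000 ≤ Mo.good.card)
    (hL : 3 * (colL U x + rowL U e1 + symL U v + colL U a + rowL U e2 + symL U u) ≤ Mo.good.card)
    (hU : 150 * U.card ≤ Mo.good.card ^ 2) :
    ∃ P Ng : Multiset (Trp V), P.map pRC = Ng.map pRC ∧ P.map pRS = Ng.map pRS ∧
      P.map pCS + {(x, v)} + {(a, u)} = Ng.map pCS + {(x, u)} + {(a, v)} ∧
      Ng.Nodup ∧ (∀ t ∈ Ng, Mo.M t.1 t.2.1 t.2.2) ∧ (∀ t ∈ Ng, t ∉ U) ∧ Multiset.card Ng ≤ 16 := by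
  obtain ⟨P, Ng, F⟩ := filler_RS Mo.swapRC (U.map ⟨swpRC, swpRC_inj⟩) x a u v e1 e2
    hxa huv h1 h2 (by rw [mem_RC]; exact n1) (by rw [mem_RC]; exact n2)
    hN (by
      simp only [rowL_RC, colL_RC, symL_RC]
      show _ ≤ Mo.good.card
      omega) (by rw [Finset.card_map]; exact hU)
  refine ⟨P.map swpRC, Ng.map swpRC, ?_, ?_, ?_, ?_, ?_, ?_, ?_⟩
  · rw [Multiset.map_map, Multiset.map_map]
    have := congrArg (Multiset.map Prod.swap) F.rc
    rw [← map_swap_pair P pRC (pRC ∘ swpRC) (fun _ => rfl),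
      ← map_swap_pair Ng pRC (pRC ∘ swpRC) (fun _ => rfl)] at this
    exact this
  · rw [Multiset.map_map, Multiset.map_map]
    exact F.cs
  · rw [Multiset.map_map, Multiset.map_map]
    exact F.rs
  · exact F.nodup.map swpRC_inj
  · intro t ht
    obtain ⟨t', ht', rfl⟩ := Multiset.mem_map.1 ht
    exact F.nat t' ht'
  · intro t ht
    obtain ⟨t', ht', rfl⟩ := Multiset.mem_map.1 ht
    have := F.av t' ht'
    rw [mem_RC] at this
    exact this
  · rw [Multiset.card_map]; exact F.card

/-- filler with boundary on row-column pairs -/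
theorem filler_RC (Mo : QModel V) (U : Finset (Trp V)) (x a u v e1 e2 : V)
    (hxa : x ≠ a) (huv : u ≠ v)
    (h1 : Mo.M x v e1) (h2 : Mo.M a u e2)
    (n1 : (x, v, e1) ∉ U) (n2 : (a, u, e2) ∉ U) (hN : 10000 ≤ Mo.good.card)
    (hL : 3 * (rowL U x + symL U e1 + colL U v + rowL U a + symL U e2 + colL U u) ≤ Mo.good.card)
    (hU : 150 * U.card ≤ Mo.good.card ^ 2) :
    ∃ P Ng : Multiset (Trp V), P.map pRS = Ng.map pRS ∧ P.map pCS = Ng.map pCS ∧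
      P.map pRC + {(x, v)} + {(a, u)} = Ng.map pRC + {(x, u)} + {(a, v)} ∧
      Ng.Nodup ∧ (∀ t ∈ Ng, Mo.M t.1 t.2.1 t.2.2) ∧ (∀ t ∈ Ng, t ∉ U) ∧ Multiset.card Ng ≤ 16 := by
  obtain ⟨P, Ng, F⟩ := filler_RS Mo.swapCS (U.map ⟨swpCS, swpCS_inj⟩) x a u v e1 e2
    hxa huv h1 h2 (by rw [mem_CS]; exact n1) (by rw [mem_CS]; exact n2)
    hN (by
      simp only [rowL_CS, colL_CS, symL_CS]
      show _ ≤ Mo.good.card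
      omega) (by rw [Finset.card_map]; exact hU)
  refine ⟨P.map swpCS, Ng.map swpCS, ?_, ?_, ?_, ?_, ?_, ?_, ?_⟩
  · rw [Multiset.map_map, Multiset.map_map]
    exact F.rc
  · rw [Multiset.map_map, Multiset.map_map]
    have := congrArg (Multiset.map Prod.swap) F.cs
    rw [← map_swap_pair P pCS (pCS ∘ swpCS) (fun _ => rfl),
      ← map_swap_pair Ng pCS (pCS ∘ swpCS) (fun _ => rfl)] at this
    exact this
  · rw [Multiset.map_map, Multiset.map_map]
    exact F.rs
  · exact F.nodup.map swpCS_inj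
  · intro t ht
    obtain ⟨t', ht', rfl⟩ := Multiset.mem_map.1 ht
    exact F.nat t' ht'
  · intro t ht
    obtain ⟨t', ht', rfl⟩ := Multiset.mem_map.1 ht
    have := F.av t' ht'
    rw [mem_CS] at this
    exact this
  · rw [Multiset.card_map]; exact F.card

end Swaps

section CorePieces

set_option linter.unusedSimpArgs false

variable {V : Type*}

def oldTrp (i j s t j1 i1 x y u x1 q y3 a b v v3 : V) : Multiset (Trp V) :=
  {(i, j, t)} + {(i, j1, s)} + {(i1, j, s)} + {(i, y, u)} + {(x, j, q)} + {(x, y, t)}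
      + {(a, b, s)} + {(x1, j1, u)} + {(a, j1, v)} + {(i1, y3, q)} + {(i1, b, v3)}

def newTrp (i j s t j1 i1 x y u x1 q y3 a b v v3 : V) : Multiset (Trp V) :=
  {(i, j, s)} + {(i, j1, u)} + {(i, y, t)} + {(x, j, t)} + {(i1, j, q)}
    + {(a, j1, s)} + {(i1, b, s)} + {(x1, j1, v)} + {(i1, y3, v3)} + {(a, y, u)} + {(x, b, q)}

variable (i j s t j1 i1 x y u x1 q y3 a b v v3 : V)

theorem old_mem (w : Trp V) : w ∈ oldTrp i j s t j1 i1 x y u x1 q y3 a b v v3 ↔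
    w = (i, j, t) ∨ w = (i, j1, s) ∨ w = (i1, j, s) ∨ w = (i, y, u) ∨
      w = (x, j, q) ∨ w = (x, y, t) ∨ w = (a, b, s) ∨ w = (x1, j1, u) ∨ w = (a, j1, v) ∨
      w = (i1, y3, q) ∨ w = (i1, b, v3) := by
  simp only [oldTrp, Multiset.mem_add, Multiset.mem_singleton, or_assoc]

theorem old_card : Multiset.card (oldTrp i j s t j1 i1 x y u x1 q y3 a b v v3) = 11 := by
  simp [oldTrp]

theorem new_mem : (i, j, s) ∈ newTrp i j s t j1 i1 x y u x1 q y3 a b v v3 := by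
  simp [newTrp]

theorem old_rs (A B : Multiset (V × V)) (h : A + {(x1, v)} + {(a, u)} = B + {(x1, u)} + {(a, v)}) :
    (newTrp i j s t j1 i1 x y u x1 q y3 a b v v3).map pRS + A =
    (oldTrp i j s t j1 i1 x y u x1 q y3 a b v v3).map pRS + B := by
  simp only [newTrp, oldTrp, Multiset.map_add, Multiset.map_singleton, pRS]
  calc _ = (A + {(x1, v)} + {(a, u)}) + ({(i, s)} + {(i, u)} + {(i, t)} + {(x, t)} + {(i1, q)}
            + {(a, s)} + {(i1, s)} + {(i1, v3)} + {(x, q)}) := by abel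
    _ = _ := by rw [h]; abel

theorem old_cs (A B : Multiset (V × V)) (h : A + {(y3, v3)} + {(b, q)} = B + {(y3, q)} + {(b, v3)}) :
    (newTrp i j s t j1 i1 x y u x1 q y3 a b v v3).map pCS + A =
    (oldTrp i j s t j1 i1 x y u x1 q y3 a b v v3).map pCS + B := by
  simp only [newTrp, oldTrp, Multiset.map_add, Multiset.map_singleton, pCS]
  calc _ = (A + {(y3, v3)} + {(b, q)}) + ({(j, s)} + {(j1, u)} + {(y, t)} + {(j, t)} + {(j, q)}
            + {(j1, s)} + {(b, s)} + {(j1, v)} + {(y, u)}) := by abel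
    _ = _ := by rw [h]; abel

theorem old_rc (A B : Multiset (V × V)) (h : A + {(x, b)} + {(a, y)} = B + {(x, y)} + {(a, b)}) :
    (newTrp i j s t j1 i1 x y u x1 q y3 a b v v3).map pRC + A =
    (oldTrp i j s t j1 i1 x y u x1 q y3 a b v v3).map pRC + B := by
  simp only [newTrp, oldTrp, Multiset.map_add, Multiset.map_singleton, pRC]
  calc _ = (A + {(x, b)} + {(a, y)}) + ({(i, j)} + {(i, j1)} + {(i, y)} + {(x, j)} + {(i1, j)}
            + {(a, j1)} + {(i1, b)} + {(x1, j1)} + {(i1, y3)}) := by abel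
    _ = _ := by rw [h]; abel

variable {i j s t j1 i1 x y u x1 q y3 a b v v3}

theorem old_nodup
    (c1 : i ≠ i1) (c2 : j ≠ j1) (c3 : x ≠ i) (c4 : x ≠ i1) (c5 : y ≠ j) (c6 : y ≠ j1)
    (c7 : x1 ≠ i1) (c8 : x1 ≠ i) (c10 : y3 ≠ j)
    (a1 : a ≠ i) (a2 : a ≠ i1) (a3 : a ≠ x) (a4 : a ≠ x1)
    (b1 : b ≠ j) (b2 : b ≠ j1) (b3 : b ≠ y) (b4 : b ≠ y3) :
    (oldTrp i j s t j1 i1 x y u x1 q y3 a b v v3).Nodup := by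
  apply Multiset.Nodup.of_map pRC
  simp only [oldTrp, Multiset.map_singleton, pRC, Multiset.singleton_add,
    Multiset.map_cons, Multiset.cons_add, Multiset.nodup_cons, Multiset.mem_cons,
    Multiset.mem_singleton, Multiset.nodup_singleton, Prod.mk.injEq, not_or, and_true]
  simp [c1, c2, c3, c4, c5, c6, c7, c8, c10, a1, a2, a3, a4, b1, b2, b3, b4,
    c1.symm, c2.symm, c3.symm, c4.symm, c5.symm, c6.symm, c8.symm, c10.symm,
    a1.symm, a2.symm, a3.symm, a4.symm, b1.symm, b2.symm, b3.symm, b4.symm]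

theorem nat_not_old (e1 e2 d1 d2 g1 g2 : V)
    (c4 : x ≠ i1) (c6 : y ≠ j1)
    (c7 : x1 ≠ i1) (c9 : y3 ≠ j1)
    (a1 : a ≠ i) (a2 : a ≠ i1) (a3 : a ≠ x) (a4 : a ≠ x1)
    (b1 : b ≠ j) (b2 : b ≠ j1) (b3 : b ≠ y) (b4 : b ≠ y3)
    (v1 : v ≠ t) (v2 : v ≠ s) (v4 : v ≠ u) (v5 : v ≠ q)
    (w1 : v3 ≠ t) (w2 : v3 ≠ s) (w4 : v3 ≠ u) (w5 : v3 ≠ q) (us : u ≠ s) (qs : q ≠ s) :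
    (x1, e1, v) ∉ oldTrp i j s t j1 i1 x y u x1 q y3 a b v v3 ∧
    (a, e2, u) ∉ oldTrp i j s t j1 i1 x y u x1 q y3 a b v v3 ∧
    (d1, y3, v3) ∉ oldTrp i j s t j1 i1 x y u x1 q y3 a b v v3 ∧
    (d2, b, q) ∉ oldTrp i j s t j1 i1 x y u x1 q y3 a b v v3 ∧
    (a, y, g1) ∉ oldTrp i j s t j1 i1 x y u x1 q y3 a b v v3 ∧
    (x, b, g2) ∉ oldTrp i j s t j1 i1 x y u x1 q y3 a b v v3 := by
  simp only [old_mem, Prod.mk.injEq]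
  simp [c4, c6, c7, c9, a1, a2, a3, a4, b1, b2, b3, b4, v1, v2, v4, v5, w1, w2, w4, w5, us, qs,
    c4.symm, c6.symm, c7.symm, c9.symm, a1.symm, a2.symm, a3.symm, a4.symm, b1.symm, b2.symm,
    b3.symm, b4.symm, v1.symm, v2.symm, v4.symm, v5.symm, w1.symm, w2.symm, w4.symm, w5.symm]

end CorePieces

section Latin

variable {V : Type*} [Fintype V]

structure IsLat (T : Multiset (Trp V)) : Prop where
  rc : T.map pRC = Finset.univ.val
  rs : T.map pRS = Finset.univ.val
  cs : T.map pCS = Finset.univ.val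

namespace IsLat

variable {T : Multiset (Trp V)}

theorem nodup (h : IsLat T) : T.Nodup :=
  Multiset.Nodup.of_map pRC (by rw [h.rc]; exact Finset.univ.nodup)

theorem iRC (h : IsLat T) {r c s s'} (h1 : (r, c, s) ∈ T) (h2 : (r, c, s') ∈ T) : s = s' := by
  have := Multiset.inj_on_of_nodup_map (f := pRC) (s := T) (by rw [h.rc]; exact Finset.univ.nodup)
    _ h1 _ h2 rfl
  simpa using this

theorem iRS (h : IsLat T) {r c c' s} (h1 : (r, c, s) ∈ T) (h2 : (r, c', s) ∈ T) : c = c' := by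
  have := Multiset.inj_on_of_nodup_map (f := pRS) (s := T) (by rw [h.rs]; exact Finset.univ.nodup)
    _ h1 _ h2 rfl
  simpa using this

theorem iCS (h : IsLat T) {r r' c s} (h1 : (r, c, s) ∈ T) (h2 : (r', c, s) ∈ T) : r = r' := by
  have := Multiset.inj_on_of_nodup_map (f := pCS) (s := T) (by rw [h.cs]; exact Finset.univ.nodup)
    _ h1 _ h2 rfl
  simpa using this

theorem exS (h : IsLat T) (r c : V) : ∃ s, (r, c, s) ∈ T := by
  have : (r, c) ∈ T.map pRC := by rw [h.rc]; exact Finset.mem_univ _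
  obtain ⟨⟨r', c', s⟩, ht, he⟩ := Multiset.mem_map.1 this
  simp only [pRC, Prod.mk.injEq] at he
  obtain ⟨rfl, rfl⟩ := he
  exact ⟨s, ht⟩

theorem exC (h : IsLat T) (r s : V) : ∃ c, (r, c, s) ∈ T := by
  have : (r, s) ∈ T.map pRS := by rw [h.rs]; exact Finset.mem_univ _
  obtain ⟨⟨r', c', s⟩, ht, he⟩ := Multiset.mem_map.1 this
  simp only [pRS, Prod.mk.injEq] at he
  obtain ⟨rfl, rfl⟩ := he
  exact ⟨c', ht⟩

theorem exR (h : IsLat T) (c s : V) : ∃ r, (r, c, s) ∈ T := by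
  have : (c, s) ∈ T.map pCS := by rw [h.cs]; exact Finset.mem_univ _
  obtain ⟨⟨r', c', s⟩, ht, he⟩ := Multiset.mem_map.1 this
  simp only [pCS, Prod.mk.injEq] at he
  obtain ⟨rfl, rfl⟩ := he
  exact ⟨r', ht⟩

open Classical in
theorem trade (h : IsLat T) {P Ng : Multiset (Trp V)} (hnd : Ng.Nodup) (hsub : ∀ t ∈ Ng, t ∈ T)
    (h1 : P.map pRC = Ng.map pRC) (h2 : P.map pRS = Ng.map pRS) (h3 : P.map pCS = Ng.map pCS) :
    ∃ T' : Multiset (Trp V), IsLat T' ∧ (∀ t ∈ P, t ∈ T') ∧ (∀ t ∈ T, t ∉ Ng → t ∈ T') := by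
  have hle : Ng ≤ T := (Multiset.le_iff_subset hnd).2 hsub
  refine ⟨T - Ng + P, ⟨?_, ?_, ?_⟩, ?_, ?_⟩
  · rw [Multiset.map_add, h1, ← Multiset.map_add, Multiset.sub_add_cancel hle, h.rc]
  · rw [Multiset.map_add, h2, ← Multiset.map_add, Multiset.sub_add_cancel hle, h.rs]
  · rw [Multiset.map_add, h3, ← Multiset.map_add, Multiset.sub_add_cancel hle, h.cs]
  · intro t ht
    exact Multiset.mem_add.2 (Or.inr ht)
  · intro t ht hn
    have : t ∈ T - Ng + Ng := by rw [Multiset.sub_add_cancel hle]; exact ht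
    rcases Multiset.mem_add.1 this with h | h
    · exact Multiset.mem_add.2 (Or.inl h)
    · exact absurd h hn

end IsLat

set_option maxHeartbeats 1000000 in
open Classical in
theorem core_trade (Mo : QModel V) (T : Multiset (Trp V)) (hT : IsLat T) (U Q : Finset (Trp V))
    (hQU : Q ⊆ U) (hMT : ∀ r c s, Mo.M r c s → (r, c, s) ∉ U → (r, c, s) ∈ T)
    (i j s t j1 i1 x y u x1 q y3 a b v v3 e1 e2 d1 d2 g1 g2 : V)
    (hO : ∀ w ∈ oldTrp i j s t j1 i1 x y u x1 q y3 a b v v3,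
      w ∈ T ∧ w ∉ Q)
    (c1 : i ≠ i1) (c2 : j ≠ j1) (c3 : x ≠ i) (c4 : x ≠ i1) (c5 : y ≠ j) (c6 : y ≠ j1)
    (c7 : x1 ≠ i1) (c8 : x1 ≠ i) (c9 : y3 ≠ j1) (c10 : y3 ≠ j)
    (a1 : a ≠ i) (a2 : a ≠ i1) (a3 : a ≠ x) (a4 : a ≠ x1)
    (b1 : b ≠ j) (b2 : b ≠ j1) (b3 : b ≠ y) (b4 : b ≠ y3)
    (v1 : v ≠ t) (v2 : v ≠ s) (v4 : v ≠ u) (v5 : v ≠ q)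
    (w1 : v3 ≠ t) (w2 : v3 ≠ s) (w4 : v3 ≠ u) (w5 : v3 ≠ q) (us : u ≠ s) (qs : q ≠ s)
    (m1 : Mo.M x1 e1 v) (m2 : Mo.M a e2 u) (m3 : Mo.M d1 y3 v3) (m4 : Mo.M d2 b q)
    (m5 : Mo.M a y g1) (m6 : Mo.M x b g2)
    (n1 : (x1, e1, v) ∉ U) (n2 : (a, e2, u) ∉ U) (n3 : (d1, y3, v3) ∉ U) (n4 : (d2, b, q) ∉ U)
    (n5 : (a, y, g1) ∉ U) (n6 : (x, b, g2) ∉ U)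
    (k13 : ((x1, e1, v) : Trp V) ≠ (d1, y3, v3)) (k16 : ((x1, e1, v) : Trp V) ≠ (x, b, g2))
    (k24 : ((a, e2, u) : Trp V) ≠ (d2, b, q)) (k25 : ((a, e2, u) : Trp V) ≠ (a, y, g1))
    (k35 : ((d1, y3, v3) : Trp V) ≠ (a, y, g1)) (k46 : ((d2, b, q) : Trp V) ≠ (x, b, g2))
    (hN : 10000 ≤ Mo.good.card)
    (l1 : 3 * (rowL U x1 + colL U e1 + symL U v + rowL U a + colL U e2 + symL U u + 300)
      ≤ Mo.good.card)
    (l2 : 3 * (colL U y3 + rowL U d1 + symL U v3 + colL U b + rowL U d2 + symL U q + 300)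
      ≤ Mo.good.card)
    (l3 : 3 * (rowL U x + symL U g2 + colL U b + rowL U a + symL U g1 + colL U y + 300)
      ≤ Mo.good.card)
    (hU : 150 * (U.card + 50) ≤ Mo.good.card ^ 2) :
    ∃ T' : Multiset (Trp V), IsLat T' ∧ (∀ w ∈ Q, w ∈ T → w ∈ T') ∧ (i, j, s) ∈ T' ∧
      ∃ X : Finset (Trp V), X.card ≤ 59 ∧ ∀ w ∈ T, w ∉ T' → w ∈ X := by
  have ndO := old_nodup (s := s) (t := t) (u := u) (q := q) (v := v) (v3 := v3)
    c1 c2 c3 c4 c5 c6 c7 c8 c10 a1 a2 a3 a4 b1 b2 b3 b4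
  obtain ⟨o1, o2, o3, o4, o5, o6⟩ := nat_not_old e1 e2 d1 d2 g1 g2 c4 c6 c7 c9 a1 a2 a3 a4
    b1 b2 b3 b4 v1 v2 v4 v5 w1 w2 w4 w5 us qs
  have hnew := new_mem i j s t j1 i1 x y u x1 q y3 a b v v3
  have hocard := old_card i j s t j1 i1 x y u x1 q y3 a b v v3
  have mrc := old_rc i j s t j1 i1 x y u x1 q y3 a b v v3
  have mrs := old_rs i j s t j1 i1 x y u x1 q y3 a b v v3
  have mcs := old_cs i j s t j1 i1 x y u x1 q y3 a b v v3
  generalize oldTrp i j s t j1 i1 x y u x1 q y3 a b v v3 = O at *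
  generalize newTrp i j s t j1 i1 x y u x1 q y3 a b v v3 = F at *
  have cO : O.toFinset.card ≤ 11 := (Multiset.toFinset_card_le _).trans (by omega)
  have cU : ∀ W : Finset (Trp V), W.card ≤ 50 → 150 * (U ∪ W).card ≤ Mo.good.card ^ 2 := by
    intro W hW
    have := Finset.card_union_le U W
    omega
  -- first filler
  obtain ⟨P1, N1, F1⟩ : ∃ P Ng, IsFill Mo (U ∪ (O.toFinset ∪
      {(d1, y3, v3), (d2, b, q), (a, y, g1), (x, b, g2)})) 16 x1 a u v P Ng := by
    set S : Finset (Trp V) := {(d1, y3, v3), (d2, b, q), (a, y, g1), (x, b, g2)} with hS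
    set W := O.toFinset ∪ S with hW
    have cS : S.card ≤ 4 := Finset.card_le_four
    have cW : W.card ≤ 50 := (Finset.card_union_le _ _).trans (by omega)
    refine filler_RS Mo _ x1 a u v e1 e2 a4.symm v4.symm m1 m2 ?_ ?_ hN ?_ (cU W cW)
    · simp only [hW, hS, Finset.mem_union, Multiset.mem_toFinset, Finset.mem_insert,
        Finset.mem_singleton, not_or]
      refine ⟨n1, o1, k13, ?_, ?_, k16⟩
      · simp [v5]
      · simp [a4.symm]
    · simp only [hW, hS, Finset.mem_union, Multiset.mem_toFinset, Finset.mem_insert,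
        Finset.mem_singleton, not_or]
      refine ⟨n2, o2, ?_, k24, k25, ?_⟩
      · simp [w4.symm]
      · simp [a3]
    · have := rowL_union U W x1
      have := colL_union U W e1
      have := symL_union U W v
      have := rowL_union U W a
      have := colL_union U W e2
      have := symL_union U W u
      omega
  have cN1 : N1.toFinset.card ≤ 16 := (Multiset.toFinset_card_le _).trans F1.card
  have av1 : ∀ w, w ∈ ({(d1, y3, v3), (d2, b, q), (a, y, g1), (x, b, g2)} : Finset (Trp V)) → w ∉ N1 :=
    fun w hw h => F1.av w h (Finset.mem_union_right _ (Finset.mem_union_right _ hw))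
  -- second filler
  obtain ⟨P2, N2, F2rc, F2rs, F2cs, F2nd, F2nat, F2av, F2card⟩ := filler_CS Mo
      (U ∪ (O.toFinset ∪ N1.toFinset ∪ {(a, y, g1), (x, b, g2)})) y3 b q v3 d1 d2 b4.symm w5.symm m3 m4
      (by
        have := av1 (d1, y3, v3) (by simp)
        simp only [Finset.mem_union, Multiset.mem_toFinset, Finset.mem_insert,
          Finset.mem_singleton, not_or]
        refine ⟨n3, ⟨o3, this⟩, k35, ?_⟩
        simp [b4.symm])
      (by
        have := av1 (d2, b, q) (by simp)
        simp only [Finset.mem_union, Multiset.mem_toFinset, Finset.mem_insert,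
          Finset.mem_singleton, not_or]
        refine ⟨n4, ⟨o4, this⟩, ?_, k46⟩
        simp [b3]) hN
      (by
        set S : Finset (Trp V) := {(a, y, g1), (x, b, g2)} with hS
        set W := O.toFinset ∪ N1.toFinset ∪ S with hW
        have cS : S.card ≤ 2 := Finset.card_le_two
        have cW : W.card ≤ 50 := (Finset.card_union_le _ _).trans (by
          have := Finset.card_union_le O.toFinset N1.toFinset
          omega)
        have := colL_union U W y3
        have := rowL_union U W d1
        have := symL_union U W v3
        have := colL_union U W b
        have := rowL_union U W d2
        have := symL_union U W q
        omega)
      (cU _ (by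
        have h1 : ({(a, y, g1), (x, b, g2)} : Finset (Trp V)).card ≤ 2 := Finset.card_le_two
        have h2 := Finset.card_union_le O.toFinset N1.toFinset
        exact (Finset.card_union_le _ _).trans (by omega)))
  have cN2 : N2.toFinset.card ≤ 16 := (Multiset.toFinset_card_le _).trans F2card
  have av2 : ∀ w, w ∈ ({(a, y, g1), (x, b, g2)} : Finset (Trp V)) → w ∉ N2 :=
    fun w hw h => F2av w h (Finset.mem_union_right _ (Finset.mem_union_right _ hw))
  have cW3 : (O.toFinset ∪ N1.toFinset ∪ N2.toFinset).card ≤ 50 := by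
    have h2 := Finset.card_union_le O.toFinset N1.toFinset
    exact (Finset.card_union_le _ _).trans (by omega)
  -- third filler
  obtain ⟨P3, N3, F3rs, F3cs, F3rc, F3nd, F3nat, F3av, F3card⟩ := filler_RC Mo
      (U ∪ (O.toFinset ∪ N1.toFinset ∪ N2.toFinset)) x a y b g2 g1 a3.symm b3.symm m6 m5
      (by
        have := av1 (x, b, g2) (by simp)
        have := av2 (x, b, g2) (by simp)
        simp only [Finset.mem_union, Multiset.mem_toFinset, not_or]
        tauto)
      (by
        have := av1 (a, y, g1) (by simp)
        have := av2 (a, y, g1) (by simp)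
        simp only [Finset.mem_union, Multiset.mem_toFinset, not_or]
        tauto) hN
      (by
        set W := O.toFinset ∪ N1.toFinset ∪ N2.toFinset with hW
        have := rowL_union U W x
        have := symL_union U W g2
        have := colL_union U W b
        have := rowL_union U W a
        have := symL_union U W g1
        have := colL_union U W y
        omega)
      (cU _ cW3)
  obtain ⟨T', hT', hP', hQ'⟩ := hT.trade (P := F + P1 + P2 + P3) (Ng := O + N1 + N2 + N3)
    (by
      simp only [Multiset.nodup_add, Multiset.disjoint_left, Multiset.mem_add]
      refine ⟨⟨⟨ndO, F1.nodup, ?_⟩, F2nd, ?_⟩, F3nd, ?_⟩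
      · intro w h1 h2
        exact F1.av w h2 (by simp [h1])
      · intro w h1 h2
        exact F2av w h2 (by simp; tauto)
      · intro w h1 h2
        exact F3av w h2 (by simp; tauto))
    (by
      intro w hw
      simp only [Multiset.mem_add] at hw
      rcases hw with ((h | h) | h) | h
      · exact (hO w h).1
      · exact hMT _ _ _ (F1.nat w h) (fun hh => F1.av w h (Finset.mem_union_left _ hh))
      · exact hMT _ _ _ (F2nat w h) (fun hh => F2av w h (Finset.mem_union_left _ hh))
      · exact hMT _ _ _ (F3nat w h) (fun hh => F3av w h (Finset.mem_union_left _ hh)))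
    (by
      have := mrc _ _ F3rc
      simp only [Multiset.map_add, F1.rc, F2rc]
      rw [add_right_comm _ _ (Multiset.map pRC P3), add_right_comm _ _ (Multiset.map pRC P3), this]
      abel)
    (by
      have := mrs _ _ F1.rs
      simp only [Multiset.map_add, F3rs, F2rs, this])
    (by
      have := mcs _ _ F2cs
      simp only [Multiset.map_add, F3cs, F1.cs]
      rw [add_right_comm _ _ (Multiset.map pCS P2), this]
      abel)
  refine ⟨T', hT', ?_, ?_, (O + N1 + N2 + N3).toFinset, ?_, ?_⟩
  · intro w hw hwT
    refine hQ' w hwT ?_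
    intro hh
    simp only [Multiset.mem_add] at hh
    rcases hh with ((h | h) | h) | h
    · exact (hO w h).2 hw
    · exact F1.av w h (Finset.mem_union_left _ (hQU hw))
    · exact F2av w h (Finset.mem_union_left _ (hQU hw))
    · exact F3av w h (Finset.mem_union_left _ (hQU hw))
  · apply hP'
    simp [hnew]
  · refine (Multiset.toFinset_card_le _).trans ?_
    have := F1.card
    simp only [Multiset.card_add]
    omega
  · intro w hw hn
    rw [Multiset.mem_toFinset]
    by_contra h
    exact hn (hQ' w hw h)

end Latin

section Step

variable {V : Type*} [Fintype V]

open Classical in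
theorem cnt_not_good (good : Finset V) (hg : Fintype.card V ≤ good.card + 3) {X : Type*} (H : Finset X)
    (φ : X → V) (h : ∀ e ∈ H, ∀ e' ∈ H, φ e = φ e' → e = e') : cnt H (fun e => φ e ∉ good) ≤ 3 := by
  refine (card_filter_le_inj H _ goodᶜ φ ?_ ?_).trans ?_
  · intro e _ h
    simpa using h
  · intro e he e' he' _ _ hh
    exact h e he e' he' hh
  · rw [Finset.card_compl]; omega

theorem cnt_eq {X : Type*} (H : Finset X) (φ : X → V)
    (h : ∀ e ∈ H, ∀ e' ∈ H, φ e = φ e' → e = e') (w : V) : cnt H (fun e => φ e = w) ≤ 1 :=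
  card_filter_le_one _ _ (fun e he e' he' h1 h2 => h e he e' he' (h1.trans h2.symm))

open Classical in
theorem sum_cnt_le {X Y : Type*} (H : Finset X) (H' : Finset Y) (R : X → Y → Prop)
    (h : ∀ a ∈ H', ∀ x ∈ H, ∀ x' ∈ H, R x a → R x' a → x = x') :
    ∑ x ∈ H, cnt H' (R x) ≤ H'.card := by
  unfold cnt
  calc ∑ x ∈ H, (H'.filter (R x)).card = ∑ a ∈ H', (H.filter (fun x => R x a)).card :=
        Finset.sum_card_bipartiteAbove_eq_sum_card_bipartiteBelow R
    _ ≤ ∑ a ∈ H', 1 := by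
        apply Finset.sum_le_sum
        intro a ha
        rw [Finset.card_le_one]
        intro x hx x' hx'
        rw [Finset.mem_filter] at hx hx'
        exact h a ha x hx.1 x' hx'.1 hx.2 hx'.2
    _ = H'.card := by simp

open Classical in
theorem cnt_and {X : Type*} [Fintype X] (H : Finset X) (q : X → Prop) :
    cnt Finset.univ (fun a => a ∈ H ∧ q a) ≤ cnt H q := by
  unfold cnt
  apply Finset.card_le_card
  intro a ha
  simpa using ha

structure Setup (Mo : QModel V) (T : Multiset (Trp V)) (U Q : Finset (Trp V)) (K : ℕ) : Prop where
  lat : IsLat T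
  hg : Fintype.card V ≤ Mo.good.card + 3
  hN : 10000 ≤ Mo.good.card
  hK : 10000 * K ≤ Mo.good.card
  hU : 160 * U.card ≤ Mo.good.card ^ 2
  qr : ∀ r, rowL Q r ≤ K
  qc : ∀ r, colL Q r ≤ K
  qs : ∀ r, symL Q r ≤ K

theorem choose_x (Mo : QModel V) (T : Multiset (Trp V)) (U Q : Finset (Trp V)) (K : ℕ)
    (S : Setup Mo T U Q K) (i j s t j1 i1 : V) (ht : (i, j, t) ∈ T) (hj1 : (i, j1, s) ∈ T)
    (hi1 : (i1, j, s) ∈ T) (tb tv tw : V → V) :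
    ∃ x y u q x1 y3 : V, (i, y, u) ∈ T ∧ (x, j, q) ∈ T ∧ (x, y, t) ∈ T ∧ (x1, j1, u) ∈ T ∧
      (i1, y3, q) ∈ T ∧
      (x ∈ Mo.good ∧ y ∈ Mo.good ∧ u ∈ Mo.good ∧ q ∈ Mo.good ∧ x1 ∈ Mo.good ∧ y3 ∈ Mo.good) ∧
      ((i, y, u) ∉ Q ∧ (x, j, q) ∉ Q ∧ (x, y, t) ∉ Q ∧ (x1, j1, u) ∉ Q ∧ (i1, y3, q) ∉ Q) ∧
      (x ≠ i ∧ x ≠ i1 ∧ y ≠ j ∧ y ≠ j1 ∧ x1 ≠ i1 ∧ y3 ≠ j1) ∧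
      20 * (rowL U x + colL U y + symL U u + symL U q + rowL U x1 + colL U y3 +
        cnt Finset.univ (fun a => Mo.M x (tb a) (tv a)) + cnt Finset.univ (fun a => Mo.M a (tb a) u)
        + cnt Finset.univ (fun a => Mo.M a y (tw a))) ≤ Mo.good.card := by
  have hT := S.lat
  have hg := S.hg
  have hN := S.hN
  have hK := S.hK
  have hU := S.hU
  choose tS hS using hT.exS
  choose tC hC using hT.exC
  choose tR hR using hT.exR
  set H : Finset V := Finset.univ with hH
  have cH : H.card = Fintype.card V := Finset.card_univ
  set N := Mo.good.card with hNd
  have hgN : N ≤ H.card := by rw [cH]; exact Finset.card_le_univ _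
  -- the functions
  set y : V → V := fun x => tC x t with hy
  set u : V → V := fun x => tS i (y x) with hu
  set x1 : V → V := fun x => tR j1 (u x) with hx1
  set q : V → V := fun x => tS x j with hq
  set y3 : V → V := fun x => tC i1 (q x) with hy3
  have T1 : ∀ x, (x, y x, t) ∈ T := fun x => hC x t
  have T2 : ∀ x, (i, y x, u x) ∈ T := fun x => hS i (y x)
  have T3 : ∀ x, (x1 x, j1, u x) ∈ T := fun x => hR j1 (u x)
  have T4 : ∀ x, (x, j, q x) ∈ T := fun x => hS x j
  have T5 : ∀ x, (i1, y3 x, q x) ∈ T := fun x => hC i1 (q x)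
  clear_value y u x1 q y3
  have I1 : ∀ x ∈ H, ∀ x' ∈ H, y x = y x' → x = x' := by
    intro x _ x' _ h
    have a1 := T1 x; rw [h] at a1
    exact hT.iCS a1 (T1 x')
  have I2 : ∀ x ∈ H, ∀ x' ∈ H, u x = u x' → x = x' := by
    intro x hx x' hx' h
    have a1 := T2 x; rw [h] at a1
    exact I1 x hx x' hx' (hT.iRS a1 (T2 x'))
  have I3 : ∀ x ∈ H, ∀ x' ∈ H, x1 x = x1 x' → x = x' := by
    intro x hx x' hx' h
    have a1 := T3 x; rw [h] at a1
    exact I2 x hx x' hx' (hT.iRC a1 (T3 x'))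
  have I4 : ∀ x ∈ H, ∀ x' ∈ H, q x = q x' → x = x' := by
    intro x hx x' hx' h
    have a1 := T4 x; rw [h] at a1
    exact (hT.iCS a1 (T4 x'))
  have I5 : ∀ x ∈ H, ∀ x' ∈ H, y3 x = y3 x' → x = x' := by
    intro x hx x' hx' h
    have a1 := T5 x; rw [h] at a1
    exact I4 x hx x' hx' (hT.iRC a1 (T5 x'))
  have I0 : ∀ x ∈ H, ∀ x' ∈ H, (fun z : V => z) x = (fun z : V => z) x' → x = x' := fun _ _ _ _ h => h
  set Z : V → ℕ := fun x => rowL U x + colL U (y x) + symL U (u x) + symL U (q x) + rowL U (x1 x)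
    + colL U (y3 x) + cnt H (fun a => Mo.M x (tb a) (tv a))
    + cnt H (fun a => Mo.M a (tb a) (u x)) + cnt H (fun a => Mo.M a (y x) (tw a))
    with hZ
  have hsum : ∑ x ∈ H, Z x ≤ 6 * U.card + 3 * H.card := by
    simp only [hZ, Finset.sum_add_distrib]
    have s1 := sum_rowL H U (fun x => x) I0
    have s2 := sum_colL H U y I1
    have s3 := sum_symL H U u I2
    have s4 := sum_symL H U q I4
    have s5 := sum_rowL H U x1 I3
    have s6 := sum_colL H U y3 I5
    have s7 := sum_cnt_le H H (fun x a => Mo.M x (tb a) (tv a)) (fun a _ x _ x' _ h h' => Mo.uR h h')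
    have s8 := sum_cnt_le H H (fun x a => Mo.M a (tb a) (u x))
      (fun a _ x hx x' hx' h h' => I2 x hx x' hx' (Mo.uS h h'))
    have s9 := sum_cnt_le H H (fun x a => Mo.M a (y x) (tw a))
      (fun a _ x hx x' hx' h h' => I1 x hx x' hx' (Mo.uC h h'))
    beta_reduce at s1 s2 s3 s4 s5 s6 s7 s8 s9
    omega
  have hmk := markov_count H Z N 20
  set bd := cnt H (fun x => N < 20 * Z x) with hbd
  have hb : 4 * bd ≤ 3 * N + 244 := by
    by_contra hlt
    push Not at hlt
    have h1 : (3 * N + 245) * N ≤ 4 * (bd * N) := by nlinarith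
    have h2 : 4 * (bd * N) ≤ 480 * U.card + 240 * H.card := by omega
    have h3 : H.card ≤ N + 3 := by omega
    nlinarith
  obtain ⟨x, -, hav⟩ := exists_avoid H
      [ (fun x => x ∉ Mo.good, 3), (fun x => y x ∉ Mo.good, 3), (fun x => u x ∉ Mo.good, 3),
        (fun x => q x ∉ Mo.good, 3), (fun x => x1 x ∉ Mo.good, 3), (fun x => y3 x ∉ Mo.good, 3),
        (fun x => (i, y x, u x) ∈ Q, rowL Q i), (fun x => (x, j, q x) ∈ Q, colL Q j),
        (fun x => (x, y x, t) ∈ Q, symL Q t), (fun x => (x1 x, j1, u x) ∈ Q, colL Q j1),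
        (fun x => (i1, y3 x, q x) ∈ Q, rowL Q i1),
        (fun x => x = i, 1), (fun x => x = i1, 1), (fun x => y x = j, 1), (fun x => y x = j1, 1),
        (fun x => x1 x = i1, 1), (fun x => y3 x = j1, 1),
        (fun x => N < 20 * Z x, bd) ] (by
        simp only [List.forall_mem_cons]
        refine ⟨?_, ?_, ?_, ?_, ?_, ?_, ?_, ?_, ?_, ?_, ?_, ?_, ?_, ?_, ?_, ?_, ?_, le_rfl, by simp⟩
        · exact cnt_not_good Mo.good hg H _ I0
        · exact cnt_not_good Mo.good hg H _ I1
        · exact cnt_not_good Mo.good hg H _ I2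
        · exact cnt_not_good Mo.good hg H _ I4
        · exact cnt_not_good Mo.good hg H _ I3
        · exact cnt_not_good Mo.good hg H _ I5
        · exact cnt_row _ _ _ _ _ (fun e he e' he' h _ => I1 e he e' he' h)
        · exact cnt_col _ _ _ _ _ (fun e _ e' _ h _ => h)
        · exact cnt_sym _ _ _ _ _ (fun e _ e' _ h _ => h)
        · exact cnt_col _ _ _ _ _ (fun e he e' he' h _ => I3 e he e' he' h)
        · exact cnt_row _ _ _ _ _ (fun e he e' he' h _ => I5 e he e' he' h)
        · exact cnt_eq H _ I0 i
        · exact cnt_eq H _ I0 i1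
        · exact cnt_eq H _ I1 j
        · exact cnt_eq H _ I1 j1
        · exact cnt_eq H _ I3 i1
        · exact cnt_eq H _ I5 j1) (by
        simp only [List.map_cons, List.map_nil, List.sum_cons, List.sum_nil]
        have := S.qr i
        have := S.qc j
        have := S.qs t
        have := S.qc j1
        have := S.qr i1
        omega)
  simp only [List.forall_mem_cons, not_not] at hav
  obtain ⟨b1, b2, b3, b4, b5, b6, b7, b8, b9, b10, b11, b12, b13, b14, b15, b16, b17, b18, -⟩ := hav
  exact ⟨x, y x, u x, q x, x1 x, y3 x, T2 x, T4 x, T1 x, T3 x, T5 x, ⟨b1, b2, b3, b4, b5, b6⟩,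
    ⟨b7, b8, b9, b10, b11⟩, ⟨b12, b13, b14, b15, b16, b17⟩, not_lt.1 b18⟩

end Step

section Step2

variable {V : Type*} [Fintype V]

theorem choose_a (Mo : QModel V) (T : Multiset (Trp V)) (U Q : Finset (Trp V)) (K : ℕ)
    (S : Setup Mo T U Q K) (i j s t j1 i1 x y u q x1 y3 : V)
    (tb tv tw : V → V) (T1 : ∀ a, (a, tb a, s) ∈ T) (T2 : ∀ a, (a, j1, tv a) ∈ T)
    (T3 : ∀ a, (i1, tb a, tw a) ∈ T)
    (gx : x ∈ Mo.good) (gy : y ∈ Mo.good) (gu : u ∈ Mo.good) (gq : q ∈ Mo.good)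
    (gx1 : x1 ∈ Mo.good) (gy3 : y3 ∈ Mo.good)
    (hZ : 20 * (rowL U x + colL U y + symL U u + symL U q + rowL U x1 + colL U y3 +
        cnt Finset.univ (fun a => Mo.M x (tb a) (tv a)) + cnt Finset.univ (fun a => Mo.M a (tb a) u)
        + cnt Finset.univ (fun a => Mo.M a y (tw a))) ≤ Mo.good.card) :
    ∃ a : V, (a ∈ Mo.good ∧ tb a ∈ Mo.good ∧ tv a ∈ Mo.good ∧ tw a ∈ Mo.good) ∧
      ((a, tb a, s) ∉ Q ∧ (a, j1, tv a) ∉ Q ∧ (i1, tb a, tw a) ∉ Q) ∧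
      (a ≠ i ∧ a ≠ i1 ∧ a ≠ x ∧ a ≠ x1) ∧ (tb a ≠ j ∧ tb a ≠ j1 ∧ tb a ≠ y ∧ tb a ≠ y3) ∧
      (tv a ≠ t ∧ tv a ≠ s ∧ tv a ≠ u ∧ tv a ≠ q) ∧ (tw a ≠ t ∧ tw a ≠ s ∧ tw a ≠ u ∧ tw a ≠ q) ∧
      (¬ Mo.M x1 y3 (tv a) ∧ ¬ Mo.M a y u ∧ ¬ Mo.M x (tb a) q ∧ ¬ Mo.M x (tb a) (tv a) ∧
        ¬ Mo.M a (tb a) u ∧ ¬ Mo.M a y (tw a)) ∧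
      ((x1, Mo.fC x1 (tv a), tv a) ∉ U ∧ (a, Mo.fC a u, u) ∉ U ∧ (Mo.fR y3 (tw a), y3, tw a) ∉ U ∧
        (Mo.fR (tb a) q, tb a, q) ∉ U ∧ (a, y, Mo.fS a y) ∉ U ∧ (x, tb a, Mo.fS x (tb a)) ∉ U) ∧
      25 * (rowL U a + colL U (tb a) + symL U (tv a) + symL U (tw a) + colL U (Mo.fC x1 (tv a)) +
        colL U (Mo.fC a u) + rowL U (Mo.fR y3 (tw a)) + rowL U (Mo.fR (tb a) q) +
        symL U (Mo.fS a y) + symL U (Mo.fS x (tb a))) ≤ 6 * Mo.good.card := by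
  have hT := S.lat
  have hg := S.hg
  have hN := S.hN
  have hK := S.hK
  have hU := S.hU
  set H : Finset V := Finset.univ with hH
  have cH : H.card = Fintype.card V := Finset.card_univ
  set N := Mo.good.card with hNd
  have hgN : N ≤ H.card := by rw [cH]; exact Finset.card_le_univ _
  have I1 : ∀ x x', tb x = tb x' → x = x' := by
    intro x x' h
    have a1 := T1 x; rw [h] at a1
    exact hT.iCS a1 (T1 x')
  have I2 : ∀ x x', tv x = tv x' → x = x' := by
    intro x x' h
    have a1 := T2 x; rw [h] at a1
    exact (hT.iCS a1 (T2 x'))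
  have I3 : ∀ x x', tw x = tw x' → x = x' := by
    intro x x' h
    have a1 := T3 x; rw [h] at a1
    exact I1 x x' (hT.iRS a1 (T3 x'))
  classical
  set H2 : Finset V := H.filter fun a => a ∈ Mo.good ∧ tb a ∈ Mo.good ∧ tv a ∈ Mo.good ∧
    tw a ∈ Mo.good with hH2
  have memH2 : ∀ a, a ∈ H2 ↔ a ∈ Mo.good ∧ tb a ∈ Mo.good ∧ tv a ∈ Mo.good ∧ tw a ∈ Mo.good := by
    intro a
    simp [hH2, hH]
  clear_value H2
  set g : V → ℕ := fun a => rowL U a + colL U (tb a) + symL U (tv a) + symL U (tw a)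
    + colL U (Mo.fC x1 (tv a)) + colL U (Mo.fC a u) + rowL U (Mo.fR y3 (tw a))
    + rowL U (Mo.fR (tb a) q) + symL U (Mo.fS a y) + symL U (Mo.fS x (tb a)) with hgdef
  have hsum : ∑ x ∈ H2, g x ≤ 10 * U.card := by
    simp only [hgdef, Finset.sum_add_distrib]
    have s1 := sum_rowL H2 U (fun x => x) (fun _ _ _ _ h => h)
    have s2 := sum_colL H2 U tb (fun a _ a' _ h => I1 a a' h)
    have s3 := sum_symL H2 U tv (fun a _ a' _ h => I2 a a' h)
    have s4 := sum_symL H2 U tw (fun a _ a' _ h => I3 a a' h)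
    have s5 := sum_colL H2 U (fun a => Mo.fC x1 (tv a)) (by
      intro a ha a' ha' h
      have q1 := Mo.mC gx1 ((memH2 a).1 ha).2.2.1
      have q2 := Mo.mC gx1 ((memH2 a').1 ha').2.2.1
      rw [h] at q1
      exact I2 a a' (Mo.uS q1 q2))
    have s6 := sum_colL H2 U (fun a => Mo.fC a u) (by
      intro a ha a' ha' h
      have q1 := Mo.mC ((memH2 a).1 ha).1 gu
      have q2 := Mo.mC ((memH2 a').1 ha').1 gu
      rw [h] at q1
      exact (Mo.uR q1 q2))
    have s7 := sum_rowL H2 U (fun a => Mo.fR y3 (tw a)) (by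
      intro a ha a' ha' h
      have q1 := Mo.mR gy3 ((memH2 a).1 ha).2.2.2
      have q2 := Mo.mR gy3 ((memH2 a').1 ha').2.2.2
      rw [h] at q1
      exact I3 a a' (Mo.uS q1 q2))
    have s8 := sum_rowL H2 U (fun a => Mo.fR (tb a) q) (by
      intro a ha a' ha' h
      have q1 := Mo.mR ((memH2 a).1 ha).2.1 gq
      have q2 := Mo.mR ((memH2 a').1 ha').2.1 gq
      rw [h] at q1
      exact I1 a a' (Mo.uC q1 q2))
    have s9 := sum_symL H2 U (fun a => Mo.fS a y) (by
      intro a ha a' ha' h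
      have q1 := Mo.mS ((memH2 a).1 ha).1 gy
      have q2 := Mo.mS ((memH2 a').1 ha').1 gy
      rw [h] at q1
      exact (Mo.uR q1 q2))
    have s10 := sum_symL H2 U (fun a => Mo.fS x (tb a)) (by
      intro a ha a' ha' h
      have q1 := Mo.mS gx ((memH2 a).1 ha).2.1
      have q2 := Mo.mS gx ((memH2 a').1 ha').2.1
      rw [h] at q1
      exact I1 a a' (Mo.uC q1 q2))
    beta_reduce at s1 s2 s3 s4 s5 s6 s7 s8 s9 s10
    omega
  have hmk := markov_count H2 g (6 * N) 25
  set bd := cnt H2 (fun x => 6 * N < 25 * g x) with hbd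
  have hb : bd * 96 ≤ 25 * N := by
    have e1 : (16 * bd) * (6 * N) ≤ 4000 * U.card := by nlinarith
    have := card_le_of_markov (N := N) (b := 16 * bd) (c := 6) (d := 25) (by omega) e1 (by omega)
    omega
  have J0 : ∀ e ∈ H, ∀ e' ∈ H, (fun a : V => a) e = (fun a : V => a) e' → e = e' := fun _ _ _ _ h => h
  have J1 : ∀ e ∈ H, ∀ e' ∈ H, tb e = tb e' → e = e' := fun e _ e' _ h => I1 e e' h
  have J2 : ∀ e ∈ H, ∀ e' ∈ H, tv e = tv e' → e = e' := fun e _ e' _ h => I2 e e' h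
  have J3 : ∀ e ∈ H, ∀ e' ∈ H, tw e = tw e' → e = e' := fun e _ e' _ h => I3 e e' h
  obtain ⟨a, -, hav⟩ := exists_avoid H
      [ (fun a => a ∉ Mo.good, 3), (fun a => tb a ∉ Mo.good, 3), (fun a => tv a ∉ Mo.good, 3),
        (fun a => tw a ∉ Mo.good, 3),
        (fun a => (a, tb a, s) ∈ Q, symL Q s), (fun a => (a, j1, tv a) ∈ Q, colL Q j1),
        (fun a => (i1, tb a, tw a) ∈ Q, rowL Q i1),
        (fun a => a = i, 1), (fun a => a = i1, 1), (fun a => a = x, 1), (fun a => a = x1, 1),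
        (fun a => tb a = j, 1), (fun a => tb a = j1, 1), (fun a => tb a = y, 1), (fun a => tb a = y3, 1),
        (fun a => tv a = t, 1), (fun a => tv a = s, 1), (fun a => tv a = u, 1), (fun a => tv a = q, 1),
        (fun a => tw a = t, 1), (fun a => tw a = s, 1), (fun a => tw a = u, 1), (fun a => tw a = q, 1),
        (fun a => Mo.M x1 y3 (tv a), 1), (fun a => Mo.M a y u, 1), (fun a => Mo.M x (tb a) q, 1),
        (fun a => Mo.M x (tb a) (tv a), cnt H (fun a => Mo.M x (tb a) (tv a))),
        (fun a => Mo.M a (tb a) u, cnt H (fun a => Mo.M a (tb a) u)),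
        (fun a => Mo.M a y (tw a), cnt H (fun a => Mo.M a y (tw a))),
        (fun a => (x1, Mo.fC x1 (tv a), tv a) ∈ U, rowL U x1),
        (fun a => (a, Mo.fC a u, u) ∈ U, symL U u),
        (fun a => (Mo.fR y3 (tw a), y3, tw a) ∈ U, colL U y3),
        (fun a => (Mo.fR (tb a) q, tb a, q) ∈ U, symL U q),
        (fun a => (a, y, Mo.fS a y) ∈ U, colL U y),
        (fun a => (x, tb a, Mo.fS x (tb a)) ∈ U, rowL U x),
        (fun a => a ∈ H2 ∧ 6 * N < 25 * g a, bd) ] (by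
        simp only [List.forall_mem_cons]
        refine ⟨?_, ?_, ?_, ?_, ?_, ?_, ?_, ?_, ?_, ?_, ?_, ?_, ?_, ?_, ?_, ?_, ?_, ?_, ?_, ?_,
          ?_, ?_, ?_, ?_, ?_, ?_, le_rfl, le_rfl, le_rfl, ?_, ?_, ?_, ?_, ?_, ?_, ?_, by simp⟩
        · exact cnt_not_good Mo.good hg H _ J0
        · exact cnt_not_good Mo.good hg H _ J1
        · exact cnt_not_good Mo.good hg H _ J2
        · exact cnt_not_good Mo.good hg H _ J3
        · exact cnt_sym _ _ _ _ _ (fun e _ e' _ h _ => h)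
        · exact cnt_col _ _ _ _ _ (fun e _ e' _ h _ => h)
        · exact cnt_row _ _ _ _ _ (fun e _ e' _ h _ => I1 e e' h)
        · exact cnt_eq H _ J0 i
        · exact cnt_eq H _ J0 i1
        · exact cnt_eq H _ J0 x
        · exact cnt_eq H _ J0 x1
        · exact cnt_eq H _ J1 j
        · exact cnt_eq H _ J1 j1
        · exact cnt_eq H _ J1 y
        · exact cnt_eq H _ J1 y3
        · exact cnt_eq H _ J2 t
        · exact cnt_eq H _ J2 s
        · exact cnt_eq H _ J2 u
        · exact cnt_eq H _ J2 q
        · exact cnt_eq H _ J3 t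
        · exact cnt_eq H _ J3 s
        · exact cnt_eq H _ J3 u
        · exact cnt_eq H _ J3 q
        · exact card_filter_le_one _ _ (fun e _ e' _ h h' => I2 e e' (Mo.uS h h'))
        · exact card_filter_le_one _ _ (fun e _ e' _ h h' => Mo.uR h h')
        · exact card_filter_le_one _ _ (fun e _ e' _ h h' => I1 e e' (Mo.uC h h'))
        · exact cnt_row _ _ _ _ _ (fun e _ e' _ _ h => I2 e e' h)
        · exact cnt_sym _ _ _ _ _ (fun e _ e' _ h _ => h)
        · exact cnt_col _ _ _ _ _ (fun e _ e' _ _ h => I3 e e' h)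
        · exact cnt_sym _ _ _ _ _ (fun e _ e' _ _ h => I1 e e' h)
        · exact cnt_col _ _ _ _ _ (fun e _ e' _ h _ => h)
        · exact cnt_row _ _ _ _ _ (fun e _ e' _ h _ => I1 e e' h)
        · exact cnt_and _ _) (by
        simp only [List.map_cons, List.map_nil, List.sum_cons, List.sum_nil]
        have := S.qs s
        have := S.qc j1
        have := S.qr i1
        omega)
  simp only [List.forall_mem_cons, not_not] at hav
  obtain ⟨b1, b2, b3, b4, b5, b6, b7, b8, b9, b10, b11, b12, b13, b14, b15, b16, b17, b18, b19, b20,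
    b21, b22, b23, b24, b25, b26, b27, b28, b29, b30, b31, b32, b33, b34, b35, b36, -⟩ := hav
  have hgood := (memH2 a).2 ⟨b1, b2, b3, b4⟩
  exact ⟨a, ⟨b1, b2, b3, b4⟩, ⟨b5, b6, b7⟩, ⟨b8, b9, b10, b11⟩, ⟨b12, b13, b14, b15⟩,
    ⟨b16, b17, b18, b19⟩, ⟨b20, b21, b22, b23⟩, ⟨b24, b25, b26, b27, b28, b29⟩,
    ⟨b30, b31, b32, b33, b34, b35⟩, not_lt.1 (fun h => b36 ⟨hgood, h⟩)⟩

/-- One more cell can be placed. -/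
theorem step (Mo : QModel V) (T : Multiset (Trp V)) (U Q : Finset (Trp V)) (K : ℕ)
    (S : Setup Mo T U Q K) (hQU : Q ⊆ U)
    (hMT : ∀ r c s, Mo.M r c s → (r, c, s) ∉ U → (r, c, s) ∈ T)
    (i j s : V) (hrc : ∀ s', (i, j, s') ∈ Q → s' = s) (hrs : ∀ j', (i, j', s) ∈ Q → j' = j)
    (hcs : ∀ i', (i', j, s) ∈ Q → i' = i) :
    ∃ T' : Multiset (Trp V), IsLat T' ∧ (∀ w ∈ Q, w ∈ T → w ∈ T') ∧ (i, j, s) ∈ T' ∧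
      ∃ X : Finset (Trp V), X.card ≤ 59 ∧ ∀ w ∈ T, w ∉ T' → w ∈ X := by
  have hT := S.lat
  have hN := S.hN
  obtain ⟨t, ht⟩ := hT.exS i j
  obtain ⟨j1, hj1⟩ := hT.exC i s
  obtain ⟨i1, hi1⟩ := hT.exR j s
  by_cases hts : t = s
  · subst hts
    exact ⟨T, hT, fun _ _ h => h, ht, ∅, by simp, fun w h h' => absurd h h'⟩
  have c1 : i ≠ i1 := by
    rintro rfl
    exact hts (hT.iRC ht hi1)
  have c2 : j ≠ j1 := by
    rintro rfl
    exact hts (hT.iRC ht hj1)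
  choose tb T1 using fun a => hT.exC a s
  choose tv T2 using fun a => hT.exS a j1
  choose tw T3 using fun a => hT.exS i1 (tb a)
  obtain ⟨x, y, u, q, x1, y3, p1, p2, p3, p4, p5, ⟨gx, gy, gu, gq, gx1, gy3⟩, ⟨q1, q2, q3, q4, q5⟩,
    ⟨c3, c4, c5, c6, c7, c9⟩, hZ⟩ := choose_x Mo T U Q K S i j s t j1 i1 ht hj1 hi1 tb tv tw
  obtain ⟨a, ⟨ga, gb, gv, gw⟩, ⟨q6, q7, q8⟩, ⟨a1, a2, a3, a4⟩, ⟨b1, b2, b3, b4⟩, ⟨v1, v2, v4, v5⟩,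
    ⟨w1, w2, w4, w5⟩, ⟨f1, f2, f3, f4, f5, f6⟩, ⟨n1, n2, n3, n4, n5, n6⟩, hG⟩ :=
    choose_a Mo T U Q K S i j s t j1 i1 x y u q x1 y3 tb tv tw T1 T2 T3 gx gy gu gq gx1 gy3 hZ
  have us : u ≠ s := by
    rintro rfl
    exact c6 (hT.iRS p1 hj1)
  have qs : q ≠ s := by
    rintro rfl
    exact c4 (hT.iCS p2 hi1)
  have c8 : x1 ≠ i := by
    rintro rfl
    exact us (hT.iRC p4 hj1)
  have c10 : y3 ≠ j := by
    rintro rfl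
    exact qs (hT.iRC p5 hi1)
  have m1 := Mo.mC gx1 gv
  have m2 := Mo.mC ga gu
  have m3 := Mo.mR gy3 gw
  have m4 := Mo.mR gb gq
  have m5 := Mo.mS ga gy
  have m6 := Mo.mS gx gb
  have T1a := T1 a
  have T2a := T2 a
  have T3a := T3 a
  generalize tb a = b at *
  generalize tv a = v at *
  generalize tw a = v3 at *
  generalize Mo.fC x1 v = e1 at *
  generalize Mo.fC a u = e2 at *
  generalize Mo.fR y3 v3 = d1 at *
  generalize Mo.fR b q = d2 at *
  generalize Mo.fS a y = g1 at *
  generalize Mo.fS x b = g2 at *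
  refine core_trade Mo T hT U Q hQU hMT i j s t j1 i1 x y u x1 q y3 a b v v3 e1 e2 d1 d2 g1 g2
    ?_ c1 c2 c3 c4 c5 c6 c7 c8 c9 c10 a1 a2 a3 a4 b1 b2 b3 b4 v1 v2 v4 v5 w1 w2 w4 w5 us qs
    m1 m2 m3 m4 m5 m6 n1 n2 n3 n4 n5 n6 ?_ ?_ ?_ ?_ ?_ ?_ hN ?_ ?_ ?_ ?_
  · intro w hw
    rw [old_mem] at hw
    rcases hw with rfl | rfl | rfl | rfl | rfl | rfl | rfl | rfl | rfl | rfl | rfl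
    · exact ⟨ht, fun h => hts (hrc t h)⟩
    · exact ⟨hj1, fun h => c2 (hrs j1 h).symm⟩
    · exact ⟨hi1, fun h => c1 (hcs i1 h).symm⟩
    · exact ⟨p1, q1⟩
    · exact ⟨p2, q2⟩
    · exact ⟨p3, q3⟩
    · exact ⟨T1a, q6⟩
    · exact ⟨p4, q4⟩
    · exact ⟨T2a, q7⟩
    · exact ⟨p5, q5⟩
    · exact ⟨T3a, q8⟩
  · intro h
    simp only [Prod.mk.injEq] at h
    obtain ⟨rfl, rfl, rfl⟩ := h
    exact f1 m1
  · intro h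
    simp only [Prod.mk.injEq] at h
    obtain ⟨rfl, rfl, rfl⟩ := h
    exact f4 m1
  · intro h
    simp only [Prod.mk.injEq] at h
    obtain ⟨rfl, rfl, rfl⟩ := h
    exact f5 m2
  · intro h
    simp only [Prod.mk.injEq] at h
    obtain ⟨-, rfl, rfl⟩ := h
    exact f2 m2
  · intro h
    simp only [Prod.mk.injEq] at h
    obtain ⟨rfl, rfl, rfl⟩ := h
    exact f6 m3
  · intro h
    simp only [Prod.mk.injEq] at h
    obtain ⟨rfl, -, rfl⟩ := h
    exact f3 m4
  · clear * - hZ hG hN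
    generalize rowL U = fr at *
    generalize colL U = fc at *
    generalize symL U = fs at *
    generalize Mo.good.card = N at *
    linarith
  · clear * - hZ hG hN
    generalize rowL U = fr at *
    generalize colL U = fc at *
    generalize symL U = fs at *
    generalize Mo.good.card = N at *
    linarith
  · clear * - hZ hG hN
    generalize rowL U = fr at *
    generalize colL U = fc at *
    generalize symL U = fs at *
    generalize Mo.good.card = N at *
    linarith
  · have hU := S.hU
    generalize Mo.good.card = N at *
    have : 10000 * 10000 ≤ N ^ 2 := by nlinarith
    omega

end Step2

section Induct

variable {V : Type*} [Fintype V]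

open Classical in
/-- the model triples missing from `T` -/
noncomputable def missing (Mo : QModel V) (T : Multiset (Trp V)) : Finset (Trp V) :=
  Finset.univ.filter fun t => Mo.M t.1 t.2.1 t.2.2 ∧ t ∉ T

open Classical in
theorem load_mono {Q Q' : Finset (Trp V)} (h : Q ⊆ Q') (r : V) :
    rowL Q r ≤ rowL Q' r ∧ colL Q r ≤ colL Q' r ∧ symL Q r ≤ symL Q' r := by
  unfold rowL colL symL
  exact ⟨Finset.card_le_card (Finset.filter_subset_filter _ h),
    Finset.card_le_card (Finset.filter_subset_filter _ h),
    Finset.card_le_card (Finset.filter_subset_filter _ h)⟩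

open Classical in
theorem complete_all (Mo : QModel V) (T0 : Multiset (Trp V)) (h0 : IsLat T0) (K : ℕ)
    (hm : (missing Mo T0).card ≤ 3 * Mo.good.card) (R : Finset (Trp V))
    (hg : Fintype.card V ≤ Mo.good.card + 3) (hN : 10000 ≤ Mo.good.card)
    (hK : 10000 * K ≤ Mo.good.card)
    (hU : 160 * (3 * Mo.good.card + 60 * R.card) ≤ Mo.good.card ^ 2)
    (qr : ∀ r, rowL R r ≤ K) (qc : ∀ r, colL R r ≤ K) (qs : ∀ r, symL R r ≤ K)
    (hrc : ∀ i j s s', (i, j, s) ∈ R → (i, j, s') ∈ R → s' = s)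
    (hrs : ∀ i j j' s, (i, j, s) ∈ R → (i, j', s) ∈ R → j' = j)
    (hcs : ∀ i i' j s, (i, j, s) ∈ R → (i', j, s) ∈ R → i' = i) :
    ∃ T : Multiset (Trp V), IsLat T ∧ ∀ w ∈ R, w ∈ T := by
  have key : ∀ Q : Finset (Trp V), Q ⊆ R → ∃ T : Multiset (Trp V), IsLat T ∧ (∀ w ∈ Q, w ∈ T) ∧
      (missing Mo T).card ≤ 3 * Mo.good.card + 59 * Q.card := by
    intro Q
    induction Q using Finset.induction_on with
    | empty =>
      intro _
      exact ⟨T0, h0, by simp, by simpa using hm⟩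
    | insert w Q hw ih =>
      intro hs
      have hQR : Q ⊆ R := fun z hz => hs (Finset.mem_insert_of_mem hz)
      have hwR : w ∈ R := hs (Finset.mem_insert_self _ _)
      obtain ⟨T, hT, hQT, hc⟩ := ih hQR
      have hQc := Finset.card_le_card hQR
      have hUc := Finset.card_union_le (missing Mo T) Q
      have S : Setup Mo T (missing Mo T ∪ Q) Q K :=
        { lat := hT, hg := hg, hN := hN, hK := hK
          hU := by omega
          qr := fun r => (load_mono hQR r).1.trans (qr r)
          qc := fun r => (load_mono hQR r).2.1.trans (qc r)
          qs := fun r => (load_mono hQR r).2.2.trans (qs r) }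
      obtain ⟨i, j, s⟩ := w
      obtain ⟨T', hT', k1, k2, X, hX, k3⟩ := step Mo T (missing Mo T ∪ Q) Q K S
        Finset.subset_union_right
        (by
          intro r c s hM hn
          by_contra hh
          apply hn
          apply Finset.mem_union_left
          simp only [missing, Finset.mem_filter, Finset.mem_univ, true_and]
          exact ⟨hM, hh⟩)
        i j s (fun s' h => hrc i j s s' hwR (hQR h)) (fun j' h => hrs i j j' s hwR (hQR h))
        (fun i' h => hcs i i' j s hwR (hQR h))
      refine ⟨T', hT', ?_, ?_⟩
      · intro z hz
        rcases Finset.mem_insert.1 hz with rfl | hz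
        · exact k2
        · exact k1 z hz (hQT z hz)
      · have hsub : missing Mo T' ⊆ missing Mo T ∪ X := by
          intro z hz
          simp only [missing, Finset.mem_filter, Finset.mem_univ, true_and, Finset.mem_union] at hz ⊢
          by_cases hzT : z ∈ T
          · exact Or.inr (k3 z hzT hz.2)
          · exact Or.inl ⟨hz.1, hzT⟩
        have a1 := Finset.card_le_card hsub
        have a2 := Finset.card_union_le (missing Mo T) X
        rw [Finset.card_insert_of_notMem hw]
        omega
  obtain ⟨T, h1, h2, -⟩ := key R (le_refl _)
  exact ⟨T, h1, h2⟩

end Induct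

section Dihedral

theorem zmod_dvd {k : ℕ} (a b : ℤ) (h : (a : ZMod (2 * k)) = b) : ∃ c : ℤ, b - a = 2 * (k * c) := by
  rw [ZMod.intCast_eq_intCast_iff_dvd_sub] at h
  obtain ⟨c, hc⟩ := h
  exact ⟨c, by rw [hc]; push_cast; ring⟩

theorem zmod_L1 {k : ℕ} [NeZero k] (x y : ZMod (2 * k)) (hs : x.val < k ↔ y.val < k)
    (h : 2 * x = 2 * y) : x = y := by
  have hx := ZMod.val_lt x
  have hy := ZMod.val_lt y
  obtain ⟨c, hc⟩ := zmod_dvd (k := k) (2 * x.val) (2 * y.val) (by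
    push_cast; rw [ZMod.natCast_zmod_val, ZMod.natCast_zmod_val, h])
  apply ZMod.val_injective
  generalize x.val = a at *
  generalize y.val = b at *
  have h1 : (b : ℤ) - a = k * c := by linarith
  have hk : (0 : ℤ) < k := by exact_mod_cast Nat.pos_of_ne_zero (NeZero.ne k)
  have hlt : |(b : ℤ) - a| < k := by rw [abs_lt]; omega
  have := Int.eq_zero_of_abs_lt_dvd ⟨c, h1⟩ hlt
  omega

theorem zmod_L2 {k : ℕ} [NeZero k] (x y : ZMod (2 * k)) (h : 2 * x = 2 * y + 1) : False := by
  obtain ⟨c, hc⟩ := zmod_dvd (k := k) (2 * x.val) (2 * y.val + 1) (by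
    push_cast; rw [ZMod.natCast_zmod_val, ZMod.natCast_zmod_val, h])
  omega

theorem zmod_L3 {k : ℕ} [NeZero k] (x y : ZMod (2 * k)) (hs : x.val < k ↔ y.val < k)
    (h : x + y + 1 = 0) : False := by
  have hx := ZMod.val_lt x
  have hy := ZMod.val_lt y
  obtain ⟨c, hc⟩ := zmod_dvd (k := k) 0 (x.val + y.val + 1) (by
    push_cast; rw [ZMod.natCast_zmod_val, ZMod.natCast_zmod_val, h])
  generalize x.val = a at *
  generalize y.val = b at *
  have hk : (0 : ℤ) < k := by exact_mod_cast Nat.pos_of_ne_zero (NeZero.ne k)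
  by_cases ha : a < k
  · have hb := hs.1 ha
    have h1 : 0 < c := by
      by_contra hn
      have : (k : ℤ) * c ≤ 0 := by nlinarith
      omega
    have : (k : ℤ) ≤ k * c := by nlinarith
    omega
  · have hb : ¬ b < k := fun h => ha (hs.2 h)
    have h1 : 1 < c := by
      by_contra hn
      have : (k : ℤ) * c ≤ k := by nlinarith
      omega
    have : (k : ℤ) * 2 ≤ k * c := by nlinarith
    omega

/-- a complete mapping of the dihedral group -/
def theta (k : ℕ) : DihedralGroup (2 * k) → DihedralGroup (2 * k)
  | .r x => if x.val < k then .r x else .sr (-x)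
  | .sr z => if (-z).val < k then .r (-1 + z) else .sr (1 - z)

theorem theta_inj (k : ℕ) [NeZero k] : Function.Injective (theta k) := by
  rintro (x | x) (y | y) h <;> simp only [theta] at h <;> split_ifs at h with h1 h2 h2 <;>
    simp only [DihedralGroup.r.injEq, DihedralGroup.sr.injEq, reduceCtorEq] at h
  · rw [h]
  · rw [neg_injective h]
  · exact (zmod_L3 x (-y) (by tauto) (by rw [h]; ring)).elim
  · exact (zmod_L3 x (-y) (by tauto) (by linear_combination -h)).elim
  · exact (zmod_L3 y (-x) (by tauto) (by rw [← h]; ring)).elim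
  · exact (zmod_L3 y (-x) (by tauto) (by linear_combination h)).elim
  · rw [add_left_cancel h]
  · congr 1; linear_combination -h

theorem mtheta_inj (k : ℕ) [NeZero k] : Function.Injective (fun g => g * theta k g) := by
  rintro (x | x) (y | y) h <;> simp only [theta] at h <;> split_ifs at h with h1 h2 h2 <;>
    simp only [DihedralGroup.r_mul_r, DihedralGroup.r_mul_sr, DihedralGroup.sr_mul_r,
      DihedralGroup.sr_mul_sr, DihedralGroup.r.injEq, DihedralGroup.sr.injEq, reduceCtorEq] at h
  · rw [zmod_L1 x y (by tauto) (by linear_combination h)]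
  · rw [zmod_L1 x y (by tauto) (by linear_combination -h)]
  · exact (zmod_L2 x (-y) (by linear_combination h)).elim
  · exact (zmod_L2 x (-y) (by linear_combination -h)).elim
  · exact (zmod_L2 y (-x) (by linear_combination h)).elim
  · exact (zmod_L2 y (-x) (by linear_combination -h)).elim
  · rw [neg_injective (zmod_L1 (-x) (-y) (by tauto) (by linear_combination -h))]
  · rw [neg_injective (zmod_L1 (-x) (-y) (by tauto) (by linear_combination h))]

/-- parity on the dihedral group -/
def dpar {m : ℕ} : DihedralGroup m → Bool
  | .r _ => false
  | .sr _ => true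

theorem dpar_mul {m : ℕ} (a b : DihedralGroup m) : dpar (a * b) = (dpar a ^^ dpar b) := by
  rcases a with a | a <;> rcases b with b | b <;> rfl

theorem dpar_inv {m : ℕ} (a : DihedralGroup m) : dpar a⁻¹ = dpar a := by
  rcases a with a | a <;> rfl

theorem dpar_sq {m : ℕ} (a : DihedralGroup m) (h : dpar a = true) : a * a = 1 := by
  rcases a with a | a
  · simp [dpar] at h
  · simp [DihedralGroup.sr_mul_self]

end Dihedral

section Model

variable {G : Type*} [Group G] [Fintype G] [DecidableEq G]

/-- model triples on `G ⊕ Fin r` -/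
def modM {r : ℕ} : (G ⊕ Fin r) → (G ⊕ Fin r) → (G ⊕ Fin r) → Prop
  | .inl a, .inl b, .inl c => a * b = c
  | _, _, _ => False

/-- quasigroup operation and its divisions, extended by junk -/
def modF {r : ℕ} (f : G → G → G) : (G ⊕ Fin r) → (G ⊕ Fin r) → (G ⊕ Fin r)
  | .inl a, .inl b => .inl (f a b)
  | x, _ => x

/-- parity extended to the added points -/
def modP {r : ℕ} (p : G → Bool) : (G ⊕ Fin r) → Bool
  | .inl a => p a
  | .inr _ => false

/-- the model attached to a group with a suitable parity -/
def model (r : ℕ) (p : G → Bool) (pm : ∀ a b, p (a * b) = (p a ^^ p b)) (pi : ∀ a, p a⁻¹ = p a)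
    (ps : ∀ a, p a = true → a * a = 1) (t0 : G) (ht0 : p t0 = true) : QModel (G ⊕ Fin r) where
  good := Finset.univ.map Function.Embedding.inl
  M := modM
  fS := modF (fun a b => a * b)
  fC := modF (fun a c => a⁻¹ * c)
  fR := modF (fun b c => c * b⁻¹)
  p := modP p
  hS := by
    rintro (a | a) (b | b) (c | c) <;> simp [modM, modF]
  hC := by
    rintro (a | a) (b | b) (c | c) <;> simp [modM, modF]
    constructor
    · rintro rfl; simp
    · rintro rfl; simp
  hR := by
    rintro (a | a) (b | b) (c | c) <;> simp [modM, modF]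
    constructor
    · rintro rfl; simp
    · rintro rfl; simp
  par := by
    rintro (a | a) (b | b) (c | c) h <;> simp only [modM] at h
    subst h
    simp only [modP, pm]
    cases p a <;> cases p b <;> rfl
  quad := by
    rintro (a | a) (b | b) (c | c) (a' | a') (b' | b') (c' | c') h1 h2 h3 h4 <;>
      simp only [modM] at h1 h2 h3 ⊢
    have ht : p (a * a'⁻¹) = true := by
      simp only [modP] at h4
      rw [pm, pi]
      revert h4
      cases p a <;> cases p a' <;> simp
    have e := ps _ ht
    have e1 : a * a'⁻¹ * a = a' := by
      have := eq_inv_of_mul_eq_one_left e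
      rw [this]; group
    have e2 : b' = a'⁻¹ * a * b := by
      rw [mul_assoc, h1, ← h3]; group
    rw [e2, ← h2, ← mul_assoc, ← mul_assoc, e1]
  bal := by
    intro b
    have h1 : ∀ b, ((Finset.univ.map (Function.Embedding.inl : G ↪ G ⊕ Fin r)).filter
        fun g => modP p g = b).card = (Finset.univ.filter fun g : G => p g = b).card := by
      intro b
      rw [Finset.filter_map, Finset.card_map]
      rfl
    have h2 : (Finset.univ.filter fun g : G => p g = true).card
        = (Finset.univ.filter fun g : G => p g = false).card := by
      apply Finset.card_bij (fun g _ => t0 * g)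
      · intro g hg
        simp only [Finset.mem_filter, Finset.mem_univ, true_and] at hg ⊢
        rw [pm, ht0, hg]; rfl
      · intro g _ g' _ h
        exact mul_left_cancel h
      · intro g hg
        simp only [Finset.mem_filter, Finset.mem_univ, true_and] at hg
        refine ⟨t0⁻¹ * g, ?_, by group⟩
        simp only [Finset.mem_filter, Finset.mem_univ, true_and]
        rw [pm, pi, ht0, hg]; rfl
    have h3 := Finset.card_filter_add_card_filter_not (s := (Finset.univ : Finset G))
      (fun g : G => p g = true)
    simp only [Bool.not_eq_true] at h3
    rw [h1, Finset.card_map]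
    cases b <;> omega

/-- latin triples on `Fin r` -/
def finM {r : ℕ} (a b c : Fin r) : Prop := (a.val + b.val + c.val) % r = 0

theorem finM_ex {r : ℕ} (hr : r ≤ 3) (a b : Fin r) : ∃! c, finM a b c := by
  unfold finM ExistsUnique
  revert a b
  interval_cases r <;> decide

theorem finM_ex2 {r : ℕ} (hr : r ≤ 3) (a c : Fin r) : ∃! b, finM a b c := by
  unfold finM ExistsUnique
  revert a c
  interval_cases r <;> decide

theorem finM_ex3 {r : ℕ} (hr : r ≤ 3) (b c : Fin r) : ∃! a, finM a b c := by
  unfold finM ExistsUnique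
  revert b c
  interval_cases r <;> decide

/-- the initial latin square as a relation -/
def iniR {r : ℕ} (θ : G → G) (h : Fin r → G) : (G ⊕ Fin r) → (G ⊕ Fin r) → (G ⊕ Fin r) → Prop
  | .inl a, .inl b, .inl c => a * b = c ∧ ∀ t, b ≠ θ a * h t
  | .inl a, .inl b, .inr t => b = θ a * h t
  | .inl a, .inr t, .inl c => c = a * θ a * h t
  | .inr t, .inl b, .inl c => ∃ a, b = θ a * h t ∧ c = a * θ a * h t
  | .inr t, .inr t', .inr t'' => finM t t' t''
  | _, _, _ => False

variable {r : ℕ} (θ : G → G) (h : Fin r → G)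

theorem iniR_rc (hr : r ≤ 3) (hh : Function.Injective h) (hθ : Function.Bijective θ) :
    ∀ a b, ∃! c, iniR θ h a b c := by
  rintro (a | t) (b | t')
  · by_cases e : ∃ t, b = θ a * h t
    · obtain ⟨t, ht⟩ := e
      refine ⟨.inr t, ht, ?_⟩
      rintro (c | t') hc
      · exact (hc.2 t ht).elim
      · have : b = θ a * h t' := hc
        rw [ht] at this
        rw [hh (mul_left_cancel this)]
    · refine ⟨.inl (a * b), ⟨rfl, fun t ht => e ⟨t, ht⟩⟩, ?_⟩
      rintro (c | t') hc
      · rw [hc.1]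
      · exact (e ⟨t', hc⟩).elim
  · refine ⟨.inl (a * θ a * h t'), rfl, ?_⟩
    rintro (c | t) hc
    · exact congrArg _ hc
    · exact hc.elim
  · obtain ⟨a, ha⟩ := hθ.2 (b * (h t)⁻¹)
    refine ⟨.inl (a * θ a * h t), ⟨a, by rw [ha]; group, rfl⟩, ?_⟩
    rintro (c | t') hc
    · obtain ⟨a', h1, h2⟩ := hc
      have : a' = a := by
        apply hθ.1
        rw [ha, h1]; group
      rw [h2, this]
    · exact hc.elim
  · obtain ⟨c, hc, hu⟩ := finM_ex hr t t'
    refine ⟨.inr c, hc, ?_⟩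
    rintro (c | t'') h1
    · exact h1.elim
    · rw [hu t'' h1]

theorem iniR_rs (hr : r ≤ 3) (hh : Function.Injective h)
    (hψ : Function.Bijective fun a => a * θ a) :
    ∀ a c, ∃! b, iniR θ h a b c := by
  rintro (a | t) (c | t')
  · by_cases e : ∃ t, c = a * θ a * h t
    · obtain ⟨t, ht⟩ := e
      refine ⟨.inr t, ht, ?_⟩
      rintro (b | t') hc
      · exact (hc.2 t (by rw [← mul_right_inj a, hc.1, ht]; group)).elim
      · have : c = a * θ a * h t' := hc
        rw [ht] at this
        rw [hh (mul_left_cancel this)]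
    · refine ⟨.inl (a⁻¹ * c), ⟨by group, fun t ht => e ⟨t, ?_⟩⟩, ?_⟩
      · rw [mul_assoc, ← ht]; group
      rintro (b | t') hc
      · rw [← hc.1]; simp
      · exact (e ⟨t', hc⟩).elim
  · refine ⟨.inl (θ a * h t'), rfl, ?_⟩
    rintro (c | t) hc
    · exact congrArg _ hc
    · exact hc.elim
  · obtain ⟨a, ha⟩ := hψ.2 (c * (h t)⁻¹)
    simp only at ha
    refine ⟨.inl (θ a * h t), ⟨a, rfl, by rw [ha]; group⟩, ?_⟩
    rintro (b | t') hc
    · obtain ⟨a', h1, h2⟩ := hc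
      have : a' = a := by
        apply hψ.1
        simp only
        rw [ha, h2]; group
      rw [h1, this]
    · exact hc.elim
  · obtain ⟨c, hc, hu⟩ := finM_ex2 hr t t'
    refine ⟨.inr c, hc, ?_⟩
    rintro (c | t'') h1
    · exact h1.elim
    · rw [hu t'' h1]

theorem iniR_cs (hr : r ≤ 3) (hh : Function.Injective h) (hθ : Function.Bijective θ)
    (hψ : Function.Bijective fun a => a * θ a) :
    ∀ b c, ∃! a, iniR θ h a b c := by
  rintro (b | t) (c | t')
  · by_cases e : ∃ t, b = θ (c * b⁻¹) * h t
    · obtain ⟨t, ht⟩ := e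
      refine ⟨.inr t, ⟨c * b⁻¹, ht, by rw [mul_assoc, ← ht]; group⟩, ?_⟩
      rintro (a | t') hc
      · have : a = c * b⁻¹ := by rw [← hc.1]; group
        exact (hc.2 t (by rw [this]; exact ht)).elim
      · obtain ⟨a, h1, h2⟩ := hc
        have : a = c * b⁻¹ := by
          rw [h2, mul_assoc a, ← h1]; group
        rw [← this] at ht
        rw [h1] at ht
        rw [hh (mul_left_cancel ht)]
    · refine ⟨.inl (c * b⁻¹), ⟨by group, fun t ht => e ⟨t, ht⟩⟩, ?_⟩
      rintro (a | t') hc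
      · rw [← hc.1]; simp
      · obtain ⟨a, h1, h2⟩ := hc
        have : a = c * b⁻¹ := by
          rw [h2, mul_assoc a, ← h1]; group
        exact (e ⟨t', by rw [← this]; exact h1⟩).elim
  · obtain ⟨a, ha⟩ := hθ.2 (b * (h t')⁻¹)
    refine ⟨.inl a, ?_, ?_⟩
    · change b = θ a * h t'
      rw [ha]; group
    rintro (a' | t) hc
    · have h1 : b = θ a' * h t' := hc
      congr 1
      apply hθ.1
      rw [ha, h1]; group
    · exact hc.elim
  · obtain ⟨a, ha⟩ := hψ.2 (c * (h t)⁻¹)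
    simp only at ha
    refine ⟨.inl a, ?_, ?_⟩
    · change c = a * θ a * h t
      rw [ha]; group
    rintro (a' | t') hc
    · have h1 : c = a' * θ a' * h t := hc
      congr 1
      apply hψ.1
      simp only
      rw [ha, h1]; group
    · exact hc.elim
  · obtain ⟨c, hc, hu⟩ := finM_ex3 hr t t'
    refine ⟨.inr c, hc, ?_⟩
    rintro (c | t'') h1
    · exact h1.elim
    · rw [hu t'' h1]

open Classical in
/-- triples of a relation -/
noncomputable def relT {V : Type*} [Fintype V] (R : V → V → V → Prop) : Finset (Trp V) :=
  Finset.univ.filter fun t => R t.1 t.2.1 t.2.2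

theorem mem_relT {V : Type*} [Fintype V] (R : V → V → V → Prop) (a b c : V) :
    (a, b, c) ∈ relT R ↔ R a b c := by
  simp [relT]

open Classical in
theorem map_relT {V : Type*} [Fintype V] (R : V → V → V → Prop) (f : Trp V → V × V)
    (hi : ∀ t ∈ relT R, ∀ t' ∈ relT R, f t = f t' → t = t')
    (hs : ∀ z, ∃ t ∈ relT R, f t = z) : (relT R).val.map f = Finset.univ.val := by
  rw [← Finset.image_val_of_injOn (f := f) (s := relT R) (fun a ha b hb h => hi a ha b hb h)]
  congr 1
  ext z
  simp only [Finset.mem_image, Finset.mem_univ, iff_true]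
  exact hs z

theorem isLat_relT {V : Type*} [Fintype V] (R : V → V → V → Prop)
    (h1 : ∀ a b, ∃! c, R a b c) (h2 : ∀ a c, ∃! b, R a b c) (h3 : ∀ b c, ∃! a, R a b c) :
    IsLat (relT R).val := by
  refine ⟨map_relT _ _ ?_ ?_, map_relT _ _ ?_ ?_, map_relT _ _ ?_ ?_⟩
  · rintro ⟨a, b, c⟩ ht ⟨a', b', c'⟩ ht' e
    rw [mem_relT] at ht ht'
    simp only [pRC, Prod.mk.injEq] at e
    obtain ⟨rfl, rfl⟩ := e
    rw [(h1 a b).unique ht ht']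
  · rintro ⟨a, b⟩
    obtain ⟨c, hc, -⟩ := h1 a b
    exact ⟨(a, b, c), (mem_relT _ _ _ _).2 hc, rfl⟩
  · rintro ⟨a, b, c⟩ ht ⟨a', b', c'⟩ ht' e
    rw [mem_relT] at ht ht'
    simp only [pRS, Prod.mk.injEq] at e
    obtain ⟨rfl, rfl⟩ := e
    rw [(h2 a c).unique ht ht']
  · rintro ⟨a, c⟩
    obtain ⟨b, hc, -⟩ := h2 a c
    exact ⟨(a, b, c), (mem_relT _ _ _ _).2 hc, rfl⟩
  · rintro ⟨a, b, c⟩ ht ⟨a', b', c'⟩ ht' e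
    rw [mem_relT] at ht ht'
    simp only [pCS, Prod.mk.injEq] at e
    obtain ⟨rfl, rfl⟩ := e
    rw [(h3 b c).unique ht ht']
  · rintro ⟨b, c⟩
    obtain ⟨a, hc, -⟩ := h3 b c
    exact ⟨(a, b, c), (mem_relT _ _ _ _).2 hc, rfl⟩

open Classical in
theorem exists_model (k r : ℕ) (hk : 2 ≤ k) (hr : r ≤ 3) :
    ∃ (V : Type) (_ : Fintype V) (Mo : QModel V) (T0 : Multiset (Trp V)),
      Fintype.card V = 4 * k + r ∧ Mo.good.card = 4 * k ∧ IsLat T0 ∧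
      (missing Mo T0).card ≤ 3 * Mo.good.card := by
  haveI : NeZero k := ⟨by omega⟩
  have hcard : Fintype.card (DihedralGroup (2 * k)) = 4 * k := by
    rw [DihedralGroup.card]; ring
  obtain ⟨h⟩ : Nonempty (Fin r ↪ DihedralGroup (2 * k)) := by
    apply Function.Embedding.nonempty_of_card_le
    rw [hcard, Fintype.card_fin]; omega
  have hθ := Finite.injective_iff_bijective.1 (theta_inj k)
  have hψ := Finite.injective_iff_bijective.1 (mtheta_inj k)
  set Mo := model (G := DihedralGroup (2 * k)) r dpar dpar_mul dpar_inv dpar_sq (.sr 0) rfl with hMo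
  have hgc : Mo.good.card = 4 * k := by
    rw [← hcard]
    change (Finset.univ.map _).card = _
    rw [Finset.card_map, Finset.card_univ]
  refine ⟨DihedralGroup (2 * k) ⊕ Fin r, inferInstance, Mo, (relT (iniR (theta k) h)).val,
    ?_, hgc, ?_, ?_⟩
  · rw [Fintype.card_sum, hcard, Fintype.card_fin]
  · exact isLat_relT _ (iniR_rc _ _ hr h.injective hθ) (iniR_rs _ _ hr h.injective hψ)
      (iniR_cs _ _ hr h.injective hθ hψ)
  · have hsub : missing Mo (relT (iniR (theta k) h)).val ⊆
        (Finset.univ : Finset (DihedralGroup (2 * k) × Fin r)).image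
          (fun z => (.inl z.1, .inl (theta k z.1 * h z.2), .inl (z.1 * (theta k z.1 * h z.2)))) := by
      rintro ⟨a, b, c⟩ hz
      simp only [missing, Finset.mem_filter, Finset.mem_univ, true_and, Finset.mem_val,
        mem_relT] at hz
      obtain ⟨hz1, hz2⟩ := hz
      change modM a b c at hz1
      rcases a with a | a <;> rcases b with b | b <;> rcases c with c | c <;>
        simp only [modM] at hz1
      simp only [iniR, not_and, not_forall, not_not] at hz2
      obtain ⟨t, ht⟩ := hz2 hz1
      rw [Finset.mem_image]
      refine ⟨(a, t), Finset.mem_univ _, ?_⟩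
      simp only [← ht, hz1]
    have c1 := Finset.card_le_card hsub
    have c2 := Finset.card_image_le (s := (Finset.univ : Finset (DihedralGroup (2 * k) × Fin r)))
      (f := fun z => ((.inl z.1, .inl (theta k z.1 * h z.2), .inl (z.1 * (theta k z.1 * h z.2))) :
        Trp (DihedralGroup (2 * k) ⊕ Fin r)))
    rw [Finset.card_univ, Fintype.card_prod, hcard, Fintype.card_fin] at c2
    rw [hgc]
    nlinarith [c1.trans c2]

end Model

section Final

open Classical in
theorem completion_of_bounds (n K : ℕ) (P : Fin n → Fin n → Option (Fin n))
    (hP : IsPartialLatinSquare P) (hKn : 1000000 * K ≤ 98 * n) (hK1 : 1 ≤ K)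
    (hr : ∀ i, (Finset.univ.filter fun j => (P i j).isSome).card ≤ K)
    (hc : ∀ j, (Finset.univ.filter fun i => (P i j).isSome).card ≤ K)
    (hs : ∀ s, (Finset.univ.filter fun p : Fin n × Fin n => P p.1 p.2 = some s).card ≤ K) :
    ∃ L : Fin n → Fin n → Fin n, IsLatinSquare L ∧ Completes L P := by
  obtain ⟨V, iV, Mo, T0, hV, hg, hT0, hm⟩ := exists_model (n / 4) (n % 4) (by omega) (by omega)
  have hVn : Fintype.card V = n := by omega
  have e : V ≃ Fin n := Fintype.equivFinOfCardEq hVn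
  set R : Finset (Trp V) := Finset.univ.filter fun t => P (e t.1) (e t.2.1) = some (e t.2.2) with hR
  have memR : ∀ a b c, (a, b, c) ∈ R ↔ P (e a) (e b) = some (e c) := by
    intro a b c
    simp [hR]
  have qr : ∀ r, rowL R r ≤ K := by
    intro r
    refine le_trans ?_ (hr (e r))
    unfold rowL
    apply Finset.card_le_card_of_injOn (fun t => e t.2.1)
    · rintro ⟨a, b, c⟩ ht
      simp only [Finset.coe_filter, Set.mem_setOf_eq, memR] at ht
      obtain ⟨h1, rfl⟩ := ht
      simp [h1]
    · rintro ⟨a, b, c⟩ ht ⟨a', b', c'⟩ ht' h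
      simp only [Finset.coe_filter, Set.mem_setOf_eq, memR] at ht ht' h
      obtain ⟨h1, rfl⟩ := ht
      obtain ⟨h1', rfl⟩ := ht'
      obtain rfl := e.injective h
      rw [h1] at h1'
      rw [e.injective (Option.some.inj h1')]
  have qc : ∀ r, colL R r ≤ K := by
    intro r
    refine le_trans ?_ (hc (e r))
    unfold colL
    apply Finset.card_le_card_of_injOn (fun t => e t.1)
    · rintro ⟨a, b, c⟩ ht
      simp only [Finset.coe_filter, Set.mem_setOf_eq, memR] at ht
      obtain ⟨h1, rfl⟩ := ht
      simp [h1]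
    · rintro ⟨a, b, c⟩ ht ⟨a', b', c'⟩ ht' h
      simp only [Finset.coe_filter, Set.mem_setOf_eq, memR] at ht ht' h
      obtain ⟨h1, rfl⟩ := ht
      obtain ⟨h1', rfl⟩ := ht'
      obtain rfl := e.injective h
      rw [h1] at h1'
      rw [e.injective (Option.some.inj h1')]
  have qs : ∀ r, symL R r ≤ K := by
    intro r
    refine le_trans ?_ (hs (e r))
    unfold symL
    apply Finset.card_le_card_of_injOn (fun t => (e t.1, e t.2.1))
    · rintro ⟨a, b, c⟩ ht
      simp only [Finset.coe_filter, Set.mem_setOf_eq, memR] at ht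
      obtain ⟨h1, rfl⟩ := ht
      simp [h1]
    · rintro ⟨a, b, c⟩ ht ⟨a', b', c'⟩ ht' h
      simp only [Finset.coe_filter, Set.mem_setOf_eq, memR, Prod.mk.injEq] at ht ht' h
      obtain ⟨h1, rfl⟩ := ht
      obtain ⟨h1', rfl⟩ := ht'
      obtain rfl := e.injective h.1
      obtain rfl := e.injective h.2
      rfl
  have hRc : R.card ≤ n * K := by
    rw [Finset.card_eq_sum_card_fiberwise (f := fun t => t.1) (t := Finset.univ)
      (fun _ _ => Finset.mem_coe.2 (Finset.mem_univ _))]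
    refine (Finset.sum_le_card_nsmul _ _ K (fun r _ => ?_)).trans ?_
    · have := qr r
      unfold rowL at this
      convert this
    · rw [Finset.card_univ, hVn, smul_eq_mul]
  have hU : 160 * (3 * Mo.good.card + 60 * R.card) ≤ Mo.good.card ^ 2 := by
    rw [hg]
    have hn4 : n ≤ 4 * (n / 4) + 3 := by omega
    have hN : 10200 ≤ 4 * (n / 4) := by omega
    generalize 4 * (n / 4) = N at *
    have h1 : 1000000 * (n * K) ≤ 98 * (n * n) := by nlinarith
    have h2 : n * n ≤ (N + 3) * (N + 3) := Nat.mul_le_mul hn4 hn4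
    nlinarith
  obtain ⟨T, hT, hRT⟩ := complete_all Mo T0 hT0 K hm R (by omega) (by omega) (by omega) hU qr qc qs
    (by
      intro i j s s' h1 h2
      rw [memR] at h1 h2
      rw [h1] at h2
      exact (e.injective (Option.some.inj h2)).symm)
    (by
      intro i j j' s h1 h2
      rw [memR] at h1 h2
      exact e.injective (hP.1 _ _ _ _ h2 h1))
    (by
      intro i i' j s h1 h2
      rw [memR] at h1 h2
      exact e.injective (hP.2 _ _ _ _ h2 h1))
  choose f hf using hT.exS
  refine ⟨fun i j => e (f (e.symm i) (e.symm j)), ⟨?_, ?_⟩, ?_⟩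
  · intro i
    apply Finite.injective_iff_bijective.1
    intro j j' h
    have h := e.injective h
    have h1 := hf (e.symm i) (e.symm j)
    rw [h] at h1
    exact e.symm.injective (hT.iRS h1 (hf _ _))
  · intro j
    apply Finite.injective_iff_bijective.1
    intro i i' h
    have h := e.injective h
    have h1 := hf (e.symm i) (e.symm j)
    rw [h] at h1
    exact e.symm.injective (hT.iCS h1 (hf _ _))
  · intro i j s h
    have h1 : (e.symm i, e.symm j, e.symm s) ∈ R := by
      rw [memR]; simpa using h
    have h2 := hT.iRC (hRT _ h1) (hf _ _)
    simp only [← h2, Equiv.apply_symm_apply]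

end Final

/-- Every `(9.8 · 10⁻⁵)`-dense partial latin square is completable. -/
theorem dense_partial_latin_square_completable
    (n : ℕ) (hn : 0 < n) (P : Fin n → Fin n → Option (Fin n))
    (hP : IsPartialLatinSquare P) (hdense : IsEpsDense (9.8 * 10 ^ (-5 : ℤ)) P) :
    ∃ L : Fin n → Fin n → Fin n, IsLatinSquare L ∧ Completes L P := by
  have hn' : (0 : ℝ) ≤ n := Nat.cast_nonneg n
  have he : (9.8 * 10 ^ (-5 : ℤ) : ℝ) * n = 98 * n / 1000000 := by norm_num; ring
  obtain ⟨h1, h2, h3⟩ := hdense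
  rw [he] at h1 h2 h3
  set K : ℕ := ⌊(98 * n / 1000000 : ℝ)⌋₊ with hK
  have hKn : 1000000 * K ≤ 98 * n := by
    have : (K : ℝ) ≤ 98 * n / 1000000 := Nat.floor_le (by positivity)
    have h : (1000000 : ℝ) * K ≤ 98 * n := by linarith
    exact_mod_cast h
  have r1 := fun i => Nat.le_floor (h1 i)
  have r2 := fun i => Nat.le_floor (h2 i)
  have r3 := fun i => Nat.le_floor (h3 i)
  by_cases hK1 : 1 ≤ K
  · refine completion_of_bounds n K P hP hKn hK1 ?_ ?_ ?_
    · intro i; convert r1 i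
    · intro i; convert r2 i
    · intro i; convert r3 i
  · have hK0 : K = 0 := by omega
    haveI : NeZero n := ⟨hn.ne'⟩
    refine ⟨fun i j => i + j, ⟨fun i => ?_, fun j => ?_⟩, ?_⟩
    · exact Finite.injective_iff_bijective.1 (add_right_injective i)
    · exact Finite.injective_iff_bijective.1 (add_left_injective j)
    · intro i j s hs
      exfalso
      have := r1 i
      rw [← hK, hK0, Nat.le_zero, Finset.card_eq_zero] at this
      have hm : j ∈ Finset.univ.filter fun j => (P i j).isSome := by simp [hs]
      rw [this] at hm
      simp at hm
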